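/- arXiv:2512.20851 — 10 statements merged into one kernel-verified Lean document; each statement's English description precedes it below -/
import Mathlib

section
/- Assume the potential response graph G is perfect and that for every maximal clique C of G there exists r* ∈ ℛ* with C = {(T(r*,z), z) : z ∈ Z}. Let (β_z)_{z∈Z} be a family where each β_z : R_z → ℝ satisfies β_z(r) ≥ 0 for all r ∈ R_z and ∑_{r∈R_z} β_z(r) = 1. Then there exists a probability distribution Q on the functions X → R with Q(ℛ*) = 1 and β_z(r) = Q({r* ∈ ℛ* : T(r*,z) = r}) for every z ∈ Z and r ∈ R_z, if and only if for every maximal independent set I of G one has ∑_{(r,z)∈I} β_z(r) ≤ 1. -/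
open scoped Classical

variable {R X Z : Type*}

/-- `(r, z)` is a vertex of the potential response graph, i.e. `r ∈ R_z`. -/
def PRVert (T : (X → R) → Z → R) (Rstar : Finset (X → R)) (p : R × Z) : Prop :=
  ∃ rs ∈ Rstar, T rs p.2 = p.1

/-- Adjacency in the potential response graph. -/
def PRAdj (T : (X → R) → Z → R) (Rstar : Finset (X → R)) (p q : R × Z) : Prop :=
  p ≠ q ∧ ∃ rs ∈ Rstar, T rs p.2 = p.1 ∧ T rs q.2 = q.1

/-- `I` is an independent set of the potential response graph. -/
def PRIndep (T : (X → R) → Z → R) (Rstar : Finset (X → R)) (I : Finset (R × Z)) : Prop :=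
  (∀ p ∈ I, PRVert T Rstar p) ∧ ∀ p ∈ I, ∀ q ∈ I, ¬ PRAdj T Rstar p q

/-- `I` is a maximal independent set of the potential response graph. -/
def PRMaxIndep (T : (X → R) → Z → R) (Rstar : Finset (X → R)) (I : Finset (R × Z)) : Prop :=
  PRIndep T Rstar I ∧ ∀ J : Finset (R × Z), PRIndep T Rstar J → I ⊆ J → J = I

/-- `C` is a clique of the potential response graph. -/
def PRClique (T : (X → R) → Z → R) (Rstar : Finset (X → R)) (C : Finset (R × Z)) : Prop :=
  (∀ p ∈ C, PRVert T Rstar p) ∧ ∀ p ∈ C, ∀ q ∈ C, p ≠ q → PRAdj T Rstar p q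

/-- `C` is a maximal clique of the potential response graph. -/
def PRMaxClique (T : (X → R) → Z → R) (Rstar : Finset (X → R)) (C : Finset (R × Z)) : Prop :=
  PRClique T Rstar C ∧ ∀ C' : Finset (R × Z), PRClique T Rstar C' → C ⊆ C' → C' = C

/-- Chromatic number of the subgraph induced by `W`: the least `n` such that the
vertices of `W` can be properly colored with `n` colors (equivalently, partitioned
into `n` independent sets). -/
noncomputable def PRChrom (T : (X → R) → Z → R) (Rstar : Finset (X → R))
    (W : Finset (R × Z)) : ℕ :=
  sInf {n : ℕ | ∃ c : R × Z → ℕ, (∀ p ∈ W, c p < n) ∧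
    ∀ p ∈ W, ∀ q ∈ W, PRAdj T Rstar p q → c p ≠ c q}

/-- Clique number of the subgraph induced by `W`: the maximum size of a clique
contained in `W`. -/
noncomputable def PRCliqueNum (T : (X → R) → Z → R) (Rstar : Finset (X → R))
    (W : Finset (R × Z)) : ℕ :=
  sSup {n : ℕ | ∃ C : Finset (R × Z), C ⊆ W ∧ PRClique T Rstar C ∧ C.card = n}


/-- Generic clique. -/
def GClq {V : Type*} (A : V → V → Prop) (C : Finset V) : Prop :=
  ∀ p ∈ C, ∀ q ∈ C, p ≠ q → A p q

/-- Generic independent set. -/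
def GInd {V : Type*} (A : V → V → Prop) (C : Finset V) : Prop :=
  ∀ p ∈ C, ∀ q ∈ C, ¬ A p q

lemma clq_count {V : Type*} [DecidableEq V] (A : V → V → Prop) (K : Finset V) (hK : GClq A K)
    (L : Multiset (Finset V)) (hL : ∀ I ∈ L, GInd A I) :
    ∑ p ∈ K, L.countP (fun I => p ∈ I) ≤ L.card := by
  induction L using Multiset.induction_on with
  | empty => simp
  | cons I L ih =>
    simp only [Multiset.countP_cons, Finset.sum_add_distrib, Multiset.card_cons]
    have h1 := ih (fun J hJ => hL J (Multiset.mem_cons_of_mem hJ))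
    have h2 : ∑ p ∈ K, (if p ∈ I then 1 else 0) ≤ 1 := by
      rw [← Finset.sum_filter, ← Finset.card_eq_sum_ones, Finset.card_le_one]
      intro a ha b hb
      rw [Finset.mem_filter] at ha hb
      by_contra hab
      exact hL I (Multiset.mem_cons_self _ _) a ha.2 b hb.2 (hK a ha.1 b hb.1 hab)
    omega

lemma cover_aux {V : Type*} [DecidableEq V] [Fintype V] (A : V → V → Prop) (S : Finset V)
    (hperf : ∀ W ⊆ S, ∀ k, (∀ C ⊆ W, GClq A C → C.card ≤ k) →
      ∃ c : V → ℕ, (∀ p ∈ W, c p < k) ∧ ∀ p ∈ W, ∀ q ∈ W, A p q → c p ≠ c q) :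
    ∀ (n : ℕ) (w : V → ℕ) (_ : ∑ p, w p = n) (_ : ∀ p, w p ≠ 0 → p ∈ S) (k : ℕ)
      (_ : ∀ C, C ⊆ S → GClq A C → ∑ p ∈ C, w p ≤ k),
      ∃ L : Multiset (Finset V), L.card = k ∧ (∀ I ∈ L, I ⊆ S ∧ GInd A I) ∧
        ∀ p, w p ≤ L.countP (fun I => p ∈ I) := by
  intro n
  induction n using Nat.strong_induction_on with
  | _ n ih =>
  intro w hwn hwS k hk
  by_cases hw1 : ∀ p, w p ≤ 1
  · obtain ⟨c, hc1, hc2⟩ := hperf (S.filter (fun p => w p ≠ 0)) (Finset.filter_subset _ _) k (by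
      intro C hC hclq
      refine le_trans ?_ (hk C (hC.trans (Finset.filter_subset _ _)) hclq)
      rw [Finset.card_eq_sum_ones]
      refine Finset.sum_le_sum fun p hp => ?_
      have := (Finset.mem_filter.1 (hC hp)).2
      omega)
    refine ⟨(Multiset.range k).map
      (fun i => (S.filter (fun p => w p ≠ 0)).filter (fun p => c p = i)), by simp, ?_, ?_⟩
    · intro I hI
      rw [Multiset.mem_map] at hI
      obtain ⟨i, -, rfl⟩ := hI
      refine ⟨(Finset.filter_subset _ _).trans (Finset.filter_subset _ _), ?_⟩
      intro p hp q hq hpq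
      rw [Finset.mem_filter] at hp hq
      exact hc2 p hp.1 q hq.1 hpq (hp.2.trans hq.2.symm)
    · intro p
      by_cases h0 : w p = 0
      · omega
      refine (hw1 p).trans ?_
      have hp : p ∈ S.filter (fun p => w p ≠ 0) := Finset.mem_filter.2 ⟨hwS p h0, h0⟩
      refine Nat.succ_le_of_lt (Multiset.countP_pos.2 ⟨_, Multiset.mem_map.2
        ⟨c p, Multiset.mem_range.2 (hc1 p hp), rfl⟩, Finset.mem_filter.2 ⟨hp, rfl⟩⟩)
  · push Not at hw1
    obtain ⟨x, hx⟩ := hw1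
    let w' : V → ℕ := fun p => w p - if p = x then 1 else 0
    have hw'x : w' x = w x - 1 := by simp [w']
    have hw'le : ∀ p, w' p ≤ w p := fun p => Nat.sub_le _ _
    have hlt : ∑ p, w' p < n := by
      rw [← hwn]
      exact Finset.sum_lt_sum (fun p _ => hw'le p) ⟨x, Finset.mem_univ _, by omega⟩
    obtain ⟨L, hLc, hLI, hLw⟩ := ih _ hlt w' rfl (fun p hp => hwS p (by have := hw'le p; omega)) k
      (fun C hC hclq => (Finset.sum_le_sum fun p _ => hw'le p).trans (hk C hC hclq))
    have hpos : 0 < L.countP (fun I => x ∈ I) := by have := hLw x; omega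
    obtain ⟨I, hIL, hxI⟩ := Multiset.countP_pos.1 hpos
    obtain ⟨L', rfl⟩ := Multiset.exists_cons_of_mem hIL
    rw [Multiset.card_cons] at hLc
    let w'' : V → ℕ := fun p => w' p - if p ∈ I ∧ p ≠ x then 1 else 0
    have hw''le : ∀ p, w'' p ≤ w' p := fun p => Nat.sub_le _ _
    have key : ∀ C, C ⊆ S → GClq A C → ∑ p ∈ C, w'' p ≤ L'.card := by
      intro C hC hclq
      have hkC := hk C hC hclq
      have h1 : ∑ p ∈ C, w' p ≤ ∑ p ∈ C, w p := Finset.sum_le_sum fun p _ => hw'le p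
      have h2 : ∑ p ∈ C, w'' p ≤ ∑ p ∈ C, w' p := Finset.sum_le_sum fun p _ => hw''le p
      by_cases hxC : x ∈ C
      · have : ∑ p ∈ C, w' p < ∑ p ∈ C, w p :=
          Finset.sum_lt_sum (fun p _ => hw'le p) ⟨x, hxC, by omega⟩
        omega
      by_cases hv : ∃ v ∈ C, v ∈ I ∧ w' v ≠ 0
      · obtain ⟨v, hvC, hvI, hv0⟩ := hv
        have hvx : v ≠ x := fun h => hxC (h ▸ hvC)
        have : ∑ p ∈ C, w'' p < ∑ p ∈ C, w' p :=
          Finset.sum_lt_sum (fun p _ => hw''le p) ⟨v, hvC, by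
            simp [w'', hvI, hvx]; omega⟩
        omega
      · push Not at hv
        refine h2.trans (le_trans ?_ (clq_count A C hclq L'
          (fun J hJ => (hLI J (Multiset.mem_cons_of_mem hJ)).2)))
        refine Finset.sum_le_sum fun p hp => ?_
        by_cases hpI : p ∈ I
        · rw [hv p hp hpI]; exact Nat.zero_le _
        · have := hLw p
          rw [Multiset.countP_cons] at this
          simpa [hpI] using this
    obtain ⟨M, hMc, hMI, hMw⟩ := ih (∑ p, w'' p)
      (lt_of_le_of_lt (Finset.sum_le_sum fun p _ => hw''le p) hlt) w'' rfl
      (fun p hp => hwS p (by have := hw'le p; have := hw''le p; omega)) L'.card key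
    refine ⟨I ::ₘ M, by rw [Multiset.card_cons]; omega, ?_, ?_⟩
    · intro J hJ
      rcases Multiset.mem_cons.1 hJ with rfl | hJ
      · exact hLI _ hIL
      · exact hMI J hJ
    · intro p
      have h := hMw p
      rw [Multiset.countP_cons]
      by_cases hpx : p = x
      · subst hpx
        simp [w'', w', hxI] at h ⊢
        omega
      · by_cases hpI : p ∈ I
        · simp [w'', w', hpI, hpx] at h ⊢
          omega
        · simp [w'', w', hpI, hpx] at h ⊢
          omega

lemma pr_clique_le (T : (X → R) → Z → R) (Rstar : Finset (X → R)) [Fintype R] [Fintype Z]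
    (hmaxclique : ∀ C : Finset (R × Z), PRMaxClique T Rstar C →
      ∃ rs ∈ Rstar, C = Finset.univ.image fun z => (T rs z, z))
    (C : Finset (R × Z)) (hC : PRClique T Rstar C) :
    ∃ rs ∈ Rstar, C ⊆ Finset.univ.image fun z => (T rs z, z) := by
  obtain ⟨D, hCD, hD⟩ := Set.Finite.exists_le_maximal
    (Set.toFinite {D : Finset (R × Z) | PRClique T Rstar D}) hC
  obtain ⟨rs, hrs, h⟩ := hmaxclique D ⟨hD.1, fun E hE hDE => le_antisymm (hD.2 hE hDE) hDE⟩
  exact ⟨rs, hrs, h ▸ hCD⟩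

lemma pr_indep_le (T : (X → R) → Z → R) (Rstar : Finset (X → R)) [Fintype R] [Fintype Z]
    (β : Z → R → ℝ)
    (hβ0 : ∀ z r, (∃ rs ∈ Rstar, T rs z = r) → 0 ≤ β z r)
    (hI : ∀ I : Finset (R × Z), PRMaxIndep T Rstar I → ∑ p ∈ I, β p.2 p.1 ≤ 1)
    (C : Finset (R × Z)) (hC : PRIndep T Rstar C) : ∑ p ∈ C, β p.2 p.1 ≤ 1 := by
  obtain ⟨D, hCD, hD⟩ := Set.Finite.exists_le_maximal
    (Set.toFinite {D : Finset (R × Z) | PRIndep T Rstar D}) hC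
  have h := hI D ⟨hD.1, fun E hE hDE => le_antisymm (hD.2 hE hDE) hDE⟩
  refine le_trans (Finset.sum_le_sum_of_subset_of_nonneg hCD ?_) h
  intro p hp _
  exact hβ0 _ _ (hD.1.1 p hp)

lemma pr_perf (T : (X → R) → Z → R) (Rstar : Finset (X → R)) [Fintype R] [Fintype Z]
    (hperfect : ∀ W : Finset (R × Z), (∀ p ∈ W, PRVert T Rstar p) →
      PRChrom T Rstar W = PRCliqueNum T Rstar W) :
    ∀ W ⊆ Finset.univ.filter (PRVert T Rstar), ∀ k,
      (∀ C ⊆ W, GClq (PRAdj T Rstar) C → C.card ≤ k) →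
      ∃ c : R × Z → ℕ, (∀ p ∈ W, c p < k) ∧
        ∀ p ∈ W, ∀ q ∈ W, PRAdj T Rstar p q → c p ≠ c q := by
  intro W hW k hk
  have h1 : PRChrom T Rstar W ≤ k := by
    rw [hperfect W (fun p hp => (Finset.mem_filter.1 (hW hp)).2)]
    refine csSup_le ⟨0, ∅, by simp, ⟨by simp, by simp⟩, by simp⟩ ?_
    rintro n ⟨C, hCW, hC, rfl⟩
    exact hk C hCW hC.2
  have h2 := Nat.sInf_mem (s := {n : ℕ | ∃ c : R × Z → ℕ, (∀ p ∈ W, c p < n) ∧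
    ∀ p ∈ W, ∀ q ∈ W, PRAdj T Rstar p q → c p ≠ c q})
    ⟨Fintype.card (R × Z), fun p => (Fintype.equivFin (R × Z) p : ℕ), fun p _ => Fin.is_lt _, by
      intro p _ q _ hpq h
      exact hpq.1 ((Fintype.equivFin (R × Z)).injective (Fin.ext h))⟩
  obtain ⟨c, hc1, hc2⟩ := h2
  exact ⟨c, fun p hp => (hc1 p hp).trans_le h1, hc2⟩

lemma sum_countP {V : Type*} [DecidableEq V] (S : Finset V) (b : V → ℝ) (L : Multiset (Finset V))
    (hL : ∀ I ∈ L, I ⊆ S ∧ ∑ p ∈ I, b p ≤ 1) :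
    ∑ p ∈ S, ((L.countP (fun I => p ∈ I) : ℕ) : ℝ) * b p ≤ L.card := by
  induction L using Multiset.induction_on with
  | empty => simp
  | cons I L ih =>
    have h1 := ih (fun J hJ => hL J (Multiset.mem_cons_of_mem hJ))
    obtain ⟨hIS, hI1⟩ := hL I (Multiset.mem_cons_self _ _)
    simp only [Multiset.countP_cons, Multiset.card_cons, Nat.cast_add, add_mul,
      Finset.sum_add_distrib]
    have h2 : ∑ p ∈ S, (((if p ∈ I then 1 else 0 : ℕ)) : ℝ) * b p = ∑ p ∈ I, b p := by
      rw [← Finset.sum_subset hIS (f := fun p => (((if p ∈ I then 1 else 0 : ℕ)) : ℝ) * b p)]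
      · exact Finset.sum_congr rfl fun p hp => by simp [hp]
      · intro p _ hp; simp [hp]
    rw [h2]
    push_cast
    linarith

lemma pr_weight (T : (X → R) → Z → R) (Rstar : Finset (X → R)) (hRstar : Rstar.Nonempty)
    [Fintype R] [Fintype Z]
    (hperfect : ∀ W : Finset (R × Z), (∀ p ∈ W, PRVert T Rstar p) →
      PRChrom T Rstar W = PRCliqueNum T Rstar W)
    (hmaxclique : ∀ C : Finset (R × Z), PRMaxClique T Rstar C →
      ∃ rs ∈ Rstar, C = Finset.univ.image fun z => (T rs z, z))
    (β : Z → R → ℝ)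
    (hβ0 : ∀ z r, (∃ rs ∈ Rstar, T rs z = r) → 0 ≤ β z r)
    (hI : ∀ I : Finset (R × Z), PRMaxIndep T Rstar I → ∑ p ∈ I, β p.2 p.1 ≤ 1)
    (w : R × Z → ℝ) (hw : ∀ p, 0 ≤ w p) (u : ℝ)
    (hu : ∀ rs ∈ Rstar, ∑ z, w (T rs z, z) ≤ u) :
    ∑ p ∈ Finset.univ.filter (PRVert T Rstar), w p * β p.2 p.1 ≤ u := by
  set S := Finset.univ.filter (PRVert T Rstar) with hS
  have hu0 : 0 ≤ u := by
    obtain ⟨rs, hrs⟩ := hRstar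
    exact (Finset.sum_nonneg fun z _ => hw _).trans (hu rs hrs)
  have key : ∀ N : ℕ, (N : ℝ) * ∑ p ∈ S, w p * β p.2 p.1 ≤ N * u + Fintype.card (R × Z) := by
    intro N
    let n : R × Z → ℕ := fun p => if p ∈ S then ⌈(N : ℝ) * w p⌉₊ else 0
    have hb0 : (0 : ℝ) ≤ N * u + Fintype.card (R × Z) := by positivity
    obtain ⟨L, hLc, hLI, hLn⟩ := cover_aux (PRAdj T Rstar) S
      (pr_perf T Rstar hperfect) _ n rfl (fun p hp => by by_contra h; simp [n, h] at hp)
      ⌊(N : ℝ) * u + Fintype.card (R × Z)⌋₊ (by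
        intro C hCS hC
        apply Nat.le_floor
        obtain ⟨rs, hrs, hsub⟩ := pr_clique_le T Rstar hmaxclique C
          ⟨fun p hp => (Finset.mem_filter.1 (hCS hp)).2, hC⟩
        push_cast
        calc ∑ p ∈ C, (n p : ℝ) ≤ ∑ p ∈ C, ((N : ℝ) * w p + 1) := by
              refine Finset.sum_le_sum fun p hp => ?_
              simp only [n, hCS hp, if_true]
              exact (Nat.ceil_lt_add_one (mul_nonneg (Nat.cast_nonneg _) (hw p))).le
          _ = N * ∑ p ∈ C, w p + C.card := by
              rw [Finset.sum_add_distrib, Finset.mul_sum]; simp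
          _ ≤ N * u + Fintype.card (R × Z) := by
              have h1 : ∑ p ∈ C, w p ≤ u := by
                refine le_trans ?_ (hu rs hrs)
                refine (Finset.sum_le_sum_of_subset_of_nonneg hsub fun p _ _ => hw p).trans ?_
                rw [Finset.sum_image]
                intro a _ b _ hab
                exact (Prod.ext_iff.1 hab).2
              have h2 : (C.card : ℝ) ≤ Fintype.card (R × Z) := by
                exact_mod_cast Finset.card_le_univ C
              gcongr)
    calc (N : ℝ) * ∑ p ∈ S, w p * β p.2 p.1 = ∑ p ∈ S, (N * w p) * β p.2 p.1 := by
          rw [Finset.mul_sum]; exact Finset.sum_congr rfl fun p _ => by ring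
      _ ≤ ∑ p ∈ S, ((L.countP (fun I => p ∈ I) : ℕ) : ℝ) * β p.2 p.1 := by
          refine Finset.sum_le_sum fun p hp => ?_
          refine mul_le_mul_of_nonneg_right ?_ (hβ0 _ _ (Finset.mem_filter.1 hp).2)
          refine le_trans ?_ (Nat.cast_le.2 (hLn p))
          simp only [n, hp, if_true]
          exact Nat.le_ceil _
      _ ≤ L.card := sum_countP S (fun p => β p.2 p.1) L (fun I hIL => ⟨(hLI I hIL).1,
          pr_indep_le T Rstar β hβ0 hI I
            ⟨fun p hp => (Finset.mem_filter.1 ((hLI I hIL).1 hp)).2, (hLI I hIL).2⟩⟩)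
      _ ≤ _ := by rw [hLc]; exact Nat.floor_le hb0
  by_contra hlt
  push Not at hlt
  obtain ⟨N, hN⟩ := exists_nat_gt
    ((Fintype.card (R × Z) : ℝ) / (∑ p ∈ S, w p * β p.2 p.1 - u))
  rw [div_lt_iff₀ (by linarith)] at hN
  have := key N
  linarith


/-- If the potential response graph `G` is perfect and every maximal
clique of `G` is of the form `{(T(r*,z), z) : z ∈ Z}` for some `r* ∈ ℛ*`, then a
family `(β_z)` of conditional pmf's on the sets `R_z` arises from a probability
distribution `Q` on `X → R` with `Q(ℛ*) = 1` if and only if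
`∑_{(r,z) ∈ I} β_z(r) ≤ 1` for every maximal independent set `I` of `G`. -/
theorem stmt_2 [Fintype R] [Fintype X] [Fintype Z]
    [Nonempty R] [Nonempty X] [Nonempty Z]
    (T : (X → R) → Z → R)
    (Rstar : Finset (X → R)) (hRstar : Rstar.Nonempty)
    (hperfect : ∀ W : Finset (R × Z), (∀ p ∈ W, PRVert T Rstar p) →
      PRChrom T Rstar W = PRCliqueNum T Rstar W)
    (hmaxclique : ∀ C : Finset (R × Z), PRMaxClique T Rstar C →
      ∃ rs ∈ Rstar, C = Finset.univ.image fun z => (T rs z, z))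
    (β : Z → R → ℝ)
    (hβ0 : ∀ z r, (∃ rs ∈ Rstar, T rs z = r) → 0 ≤ β z r)
    (hβ1 : ∀ z, ∑ r ∈ Finset.univ.filter (fun r => ∃ rs ∈ Rstar, T rs z = r), β z r = 1) :
    (∃ Q : (X → R) → ℝ,
        (∀ f, 0 ≤ Q f) ∧
        (∑ f : X → R, Q f = 1) ∧
        (∑ f ∈ Rstar, Q f = 1) ∧
        ∀ z r, (∃ rs ∈ Rstar, T rs z = r) →
          β z r = ∑ f ∈ Rstar.filter (fun f => T f z = r), Q f)
    ↔ ∀ I : Finset (R × Z), PRMaxIndep T Rstar I → ∑ p ∈ I, β p.2 p.1 ≤ 1 := by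
  constructor
  · rintro ⟨Q, hQ0, -, hQ1, hQ⟩ I ⟨⟨hIv, hIi⟩, -⟩
    calc ∑ p ∈ I, β p.2 p.1
        = ∑ p ∈ I, ∑ f ∈ Rstar, (if T f p.2 = p.1 then Q f else 0) := by
          refine Finset.sum_congr rfl fun p hp => ?_
          rw [hQ _ _ (hIv p hp), Finset.sum_filter]
      _ = ∑ f ∈ Rstar, ∑ p ∈ I, (if T f p.2 = p.1 then Q f else 0) := Finset.sum_comm
      _ ≤ ∑ f ∈ Rstar, Q f := by
          refine Finset.sum_le_sum fun f hf => ?_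
          rw [← Finset.sum_filter, Finset.sum_const, nsmul_eq_mul]
          have h : (I.filter (fun p => T f p.2 = p.1)).card ≤ 1 := by
            rw [Finset.card_le_one]
            intro a ha b hb
            rw [Finset.mem_filter] at ha hb
            by_contra hab
            exact hIi a ha.1 b hb.1 ⟨hab, f, hf, ha.2, hb.2⟩
          have h' : ((I.filter (fun p => T f p.2 = p.1)).card : ℝ) ≤ 1 := by exact_mod_cast h
          have := mul_le_mul_of_nonneg_right h' (hQ0 f)
          linarith
      _ = 1 := hQ1
  · intro hI
    let v : Rstar → (R × Z → ℝ) := fun f p => if T f.1 p.2 = p.1 then 1 else 0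
    let φ := Fintype.linearCombination ℝ v
    let β' : R × Z → ℝ := fun p => if PRVert T Rstar p then β p.2 p.1 else 0
    have hmem : β' ∈ φ '' stdSimplex ℝ Rstar := by
      by_contra hnot
      obtain ⟨g, u, hg1, hg2⟩ := geometric_hahn_banach_closed_point
        ((convex_stdSimplex ℝ Rstar).linear_image φ)
        ((isCompact_stdSimplex ℝ Rstar).image φ.continuous_of_finiteDimensional).isClosed hnot
      have hg : ∀ a : R × Z → ℝ, g a = ∑ p, g (Pi.single p 1) * a p := by
        intro a
        conv_lhs => rw [pi_eq_sum_univ' a]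
        rw [map_sum]
        refine Finset.sum_congr rfl fun p _ => ?_
        rw [map_smul, smul_eq_mul, mul_comm]
      let c : ℝ := ∑ p : R × Z, |g (Pi.single p 1)|
      have hc : ∀ p, 0 ≤ g (Pi.single p 1) + c := by
        intro p
        have h1 : |g (Pi.single p 1)| ≤ c := Finset.single_le_sum
          (f := fun p : R × Z => |g (Pi.single p 1)|) (fun p _ => abs_nonneg _) (Finset.mem_univ p)
        have := neg_abs_le (g (Pi.single p 1))
        linarith
      have h := pr_weight T Rstar hRstar hperfect hmaxclique β hβ0 hI
        (fun p => g (Pi.single p 1) + c) hc (u + Fintype.card Z * c) (by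
          intro rs hrs
          have h1 := hg1 (v ⟨rs, hrs⟩) ⟨Pi.single ⟨rs, hrs⟩ 1, single_mem_stdSimplex _ _, by
            simp [φ, Fintype.linearCombination_apply, Pi.single_apply]⟩
          rw [hg, Fintype.sum_prod_type_right] at h1
          simp only [v, mul_ite, mul_one, mul_zero, Finset.sum_ite_eq, Finset.mem_univ,
            if_true] at h1
          rw [Finset.sum_add_distrib]
          simp only [Finset.sum_const, Finset.card_univ, nsmul_eq_mul]
          linarith)
      have hsum : ∑ p ∈ Finset.univ.filter (PRVert T Rstar), β p.2 p.1 = Fintype.card Z := by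
        rw [Finset.sum_filter, Fintype.sum_prod_type_right]
        rw [Finset.sum_congr rfl (g := fun _ => (1 : ℝ))]
        · simp
        · intro z _
          rw [← hβ1 z, Finset.sum_filter]
          refine Finset.sum_congr rfl fun r _ => ?_
          by_cases hr : ∃ rs ∈ Rstar, T rs z = r
          · rw [if_pos hr, if_pos (show PRVert T Rstar (r, z) from hr)]
          · rw [if_neg hr, if_neg (show ¬ PRVert T Rstar (r, z) from hr)]
      simp only [add_mul, Finset.sum_add_distrib, ← Finset.mul_sum, hsum] at h
      rw [hg] at hg2
      simp only [β', mul_ite, mul_zero] at hg2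
      rw [← Finset.sum_filter] at hg2
      linarith
    obtain ⟨q, ⟨hq0, hq1⟩, hq⟩ := hmem
    have hext : ∀ F : (X → R) → ℝ, ∑ f ∈ Rstar, (if h : f ∈ Rstar then q ⟨f, h⟩ else 0) * F f
        = ∑ f : Rstar, q f * F f.1 := by
      intro F
      rw [← Finset.sum_coe_sort Rstar]
      exact Finset.sum_congr rfl fun f _ => by simp
    have hR : ∑ f ∈ Rstar, (if h : f ∈ Rstar then q ⟨f, h⟩ else 0) = 1 := by
      have := hext (fun _ => 1)
      simp only [mul_one] at this
      rw [this, hq1]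
    refine ⟨fun f => if h : f ∈ Rstar then q ⟨f, h⟩ else 0, ?_, ?_, hR, ?_⟩
    · intro f
      dsimp only
      split_ifs
      · exact hq0 _
      · exact le_rfl
    · rw [← hR]
      symm
      exact Finset.sum_subset (Finset.subset_univ _) fun f _ hf => by simp [hf]
    · intro z r hzr
      have h1 := congrFun hq (r, z)
      have hv : PRVert T Rstar (r, z) := hzr
      simp only [β', hv, if_true] at h1
      rw [← h1]
      have := hext (fun f => if T f z = r then 1 else 0)
      rw [Finset.sum_filter]
      simp only [φ, Fintype.linearCombination_apply, Finset.sum_apply, Pi.smul_apply, smul_eq_mul, v]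
      rw [← this]
      exact Finset.sum_congr rfl fun f _ => by split_ifs <;> simp
end

section
/- Assume the potential response graph G is perfect and that every maximal clique of G belongs to 𝒞*_G, i.e., equals C(r*) for some r* ∈ ℛ*. Let (P_z)_{z∈Z} be a family where each P_z is a probability mass function on R_z. Then there exists a probability distribution Q on ∏_{z∈Z} R_z with Q(ℛ*) = 1 whose z-th marginal equals P_z for every z ∈ Z, if and only if for every maximal independent set I of G one has ∑_{(r,z)∈I} P_z(r) ≤ 1. -/
open scoped Classical

variable {Z : Type*} {R : Z → Type*}

/-- Adjacency in the potential response graph on vertex set `Σ z, R z`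
(vertex `⟨z, r⟩` stands for the pair `(r, z)` with `r ∈ R_z`). -/
def SGAdj (Rstar : Finset (∀ z, R z)) (v w : (z : Z) × R z) : Prop :=
  v ≠ w ∧ ∃ g ∈ Rstar, g v.1 = v.2 ∧ g w.1 = w.2

/-- `I` is an independent set of the potential response graph. -/
def SGIndep (Rstar : Finset (∀ z, R z)) (I : Finset ((z : Z) × R z)) : Prop :=
  ∀ v ∈ I, ∀ w ∈ I, ¬ SGAdj Rstar v w

/-- `I` is a maximal independent set of the potential response graph. -/
def SGMaxIndep (Rstar : Finset (∀ z, R z)) (I : Finset ((z : Z) × R z)) : Prop :=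
  SGIndep Rstar I ∧ ∀ J : Finset ((z : Z) × R z), SGIndep Rstar J → I ⊆ J → J = I

/-- `C` is a clique of the potential response graph. -/
def SGClique (Rstar : Finset (∀ z, R z)) (C : Finset ((z : Z) × R z)) : Prop :=
  ∀ v ∈ C, ∀ w ∈ C, v ≠ w → SGAdj Rstar v w

/-- `C` is a maximal clique of the potential response graph. -/
def SGMaxClique (Rstar : Finset (∀ z, R z)) (C : Finset ((z : Z) × R z)) : Prop :=
  SGClique Rstar C ∧ ∀ C' : Finset ((z : Z) × R z), SGClique Rstar C' → C ⊆ C' → C' = C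

/-- Chromatic number of the subgraph induced by `W`. -/
noncomputable def SGChrom (Rstar : Finset (∀ z, R z)) (W : Finset ((z : Z) × R z)) : ℕ :=
  sInf {n : ℕ | ∃ c : ((z : Z) × R z) → ℕ, (∀ v ∈ W, c v < n) ∧
    ∀ v ∈ W, ∀ w ∈ W, SGAdj Rstar v w → c v ≠ c w}

/-- Clique number of the subgraph induced by `W`. -/
noncomputable def SGCliqueNum (Rstar : Finset (∀ z, R z)) (W : Finset ((z : Z) × R z)) : ℕ :=
  sSup {n : ℕ | ∃ C : Finset ((z : Z) × R z), C ⊆ W ∧ SGClique Rstar C ∧ C.card = n}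

lemma aux_swap {α β M : Type*} [AddCommMonoid M] (L : Multiset α) (C : Finset β)
    (f : α → β → M) :
    (L.map (fun I => ∑ u ∈ C, f I u)).sum = ∑ u ∈ C, (L.map (fun I => f I u)).sum := by
  induction L using Multiset.induction_on with
  | empty => simp
  | cons a s ih => simp [ih, Finset.sum_add_distrib]

lemma aux_weighted [Fintype Z] [∀ z, Fintype (R z)] (Rstar : Finset (∀ z, R z))
    (hperfect : ∀ W : Finset ((z : Z) × R z), SGChrom Rstar W = SGCliqueNum Rstar W) :
    ∀ (N : ℕ) (w : ((z : Z) × R z) → ℕ) (k : ℕ), ∑ v, w v = N →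
      (∀ C, SGClique Rstar C → ∑ v ∈ C, w v ≤ k) →
      ∃ L : Multiset (Finset ((z : Z) × R z)), L.card = k ∧ (∀ I ∈ L, SGIndep Rstar I) ∧
        ∀ v, w v = (L.map (fun I => if v ∈ I then 1 else 0)).sum := by
  intro N
  induction N using Nat.strong_induction_on with
  | _ N ih =>
  intro w k hN hC
  by_cases hw : ∀ v, w v ≤ 1
  · let W : Finset ((z : Z) × R z) := Finset.univ.filter (fun v => w v = 1)
    have h1 : SGCliqueNum Rstar W ≤ k := by
      unfold SGCliqueNum
      refine csSup_le ⟨0, ∅, by simp, by simp [SGClique], rfl⟩ ?_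
      rintro n ⟨C, hCW, hCl, rfl⟩
      refine le_trans (le_of_eq ?_) (hC C hCl)
      rw [Finset.card_eq_sum_ones]
      refine Finset.sum_congr rfl fun v hv => ?_
      exact ((Finset.mem_filter.1 (hCW hv)).2).symm
    have h2 : SGChrom Rstar W ∈ {n : ℕ | ∃ c : ((z : Z) × R z) → ℕ, (∀ v ∈ W, c v < n) ∧
        ∀ v ∈ W, ∀ w ∈ W, SGAdj Rstar v w → c v ≠ c w} := by
      apply Nat.sInf_mem
      refine ⟨Fintype.card ((z : Z) × R z), fun v => (Fintype.equivFin _ v : ℕ), ?_, ?_⟩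
      · intro v _
        exact (Fintype.equivFin _ v).2
      · intro v _ u _ h he
        exact h.1 ((Fintype.equivFin _).injective (Fin.ext he))
    obtain ⟨c, hc1, hc2⟩ := h2
    refine ⟨(Multiset.range k).map (fun j => W.filter (fun v => c v = j)), by simp, ?_, ?_⟩
    · intro I hI
      obtain ⟨j, _, rfl⟩ := Multiset.mem_map.1 hI
      intro v hv u hu h
      rw [Finset.mem_filter] at hv hu
      exact hc2 v hv.1 u hu.1 h (hv.2.trans hu.2.symm)
    · intro v
      rw [Multiset.map_map]
      change w v = ∑ j ∈ Finset.range k, (if v ∈ W.filter (fun v => c v = j) then 1 else 0)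
      by_cases hv : v ∈ W
      · have : c v < k := lt_of_lt_of_le (hc1 v hv) ((hperfect W).le.trans h1)
        simp only [Finset.mem_filter, hv, true_and]
        rw [Finset.sum_ite_eq]
        simp [this, (Finset.mem_filter.1 hv).2]
      · have h0 : w v ≠ 1 := fun h => hv (Finset.mem_filter.2 ⟨Finset.mem_univ _, h⟩)
        have := hw v
        simp [hv]
        omega
  · push Not at hw
    obtain ⟨v, hv⟩ := hw
    let w' : ((z : Z) × R z) → ℕ := fun u => w u - if u = v then 1 else 0
    have hw' : ∀ u, w u = w' u + if u = v then 1 else 0 := by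
      intro u
      by_cases h : u = v
      · subst h; simp [w']; omega
      · simp [w', h]
    have hs : ∑ u, w u = ∑ u, w' u + 1 := by
      rw [Finset.sum_congr rfl (fun u _ => hw' u), Finset.sum_add_distrib]
      simp
    obtain ⟨L, hL1, hL2, hL3⟩ := ih (∑ u, w' u) (by omega) w' k rfl (fun C h =>
      le_trans (Finset.sum_le_sum fun u _ => by rw [hw' u]; omega) (hC C h))
    have hS : ∃ S ∈ L, v ∈ S := by
      by_contra hcon
      push Not at hcon
      have h0 := hL3 v
      rw [Multiset.map_congr rfl (fun I hI => if_neg (hcon I hI))] at h0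
      simp at h0
      have := hw' v
      simp at this
      omega
    obtain ⟨S, hSL, hvS⟩ := hS
    obtain ⟨L', rfl⟩ := Multiset.exists_cons_of_mem hSL
    simp only [Multiset.card_cons, Multiset.map_cons, Multiset.sum_cons] at hL1 hL3
    let w2 : ((z : Z) × R z) → ℕ := fun u =>
      (L'.map (fun I => if u ∈ I then 1 else 0)).sum + if u = v then 1 else 0
    have hw2 : ∀ u, w u = (if u ∈ S then 1 else 0) + w2 u := by
      intro u
      rw [hw' u, hL3 u]
      simp only [w2]
      ring
    have hone : ∀ C I, SGClique Rstar C → SGIndep Rstar I →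
        ∑ u ∈ C, (if u ∈ I then 1 else 0) ≤ 1 := by
      intro C I h1 h2
      rw [← Finset.sum_filter, ← Finset.card_eq_sum_ones, Finset.card_le_one]
      intro a ha b hb
      rw [Finset.mem_filter] at ha hb
      by_contra hab
      exact h2 a ha.2 b hb.2 (h1 a ha.1 b hb.1 hab)
    have hC2 : ∀ C, SGClique Rstar C → ∑ u ∈ C, w2 u ≤ L'.card := by
      intro C hCl
      by_cases hvC : v ∈ C
      · have h1 := hC C hCl
        rw [Finset.sum_congr rfl (fun u _ => hw2 u), Finset.sum_add_distrib] at h1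
        have h2 : 1 ≤ ∑ u ∈ C, (if u ∈ S then 1 else 0) := by
          have := Finset.single_le_sum (f := fun u => if u ∈ S then 1 else 0)
            (fun _ _ => Nat.zero_le _) hvC
          simpa [hvS] using this
        omega
      · have h1 : ∑ u ∈ C, w2 u = ∑ u ∈ C, (L'.map (fun I => if u ∈ I then 1 else 0)).sum := by
          refine Finset.sum_congr rfl fun u hu => ?_
          have : u ≠ v := fun h => hvC (h ▸ hu)
          simp [w2, this]
        rw [h1, ← aux_swap L' C]
        refine le_trans (Multiset.sum_le_card_nsmul _ 1 ?_) (by simp)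
        intro x hx
        obtain ⟨I, hI, rfl⟩ := Multiset.mem_map.1 hx
        exact hone C I hCl (hL2 I (Multiset.mem_cons_of_mem hI))
    have hlt : ∑ u, w2 u < N := by
      rw [← hN]
      refine Finset.sum_lt_sum (fun u _ => by rw [hw2 u]; omega) ⟨v, Finset.mem_univ _, ?_⟩
      rw [hw2 v]; simp [hvS]
    obtain ⟨M, hM1, hM2, hM3⟩ := ih _ hlt w2 _ rfl hC2
    refine ⟨S ::ₘ M, by simp [hM1, hL1], ?_, ?_⟩
    · intro I hI
      rcases Multiset.mem_cons.1 hI with rfl | h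
      · exact hL2 _ (Multiset.mem_cons_self _ _)
      · exact hM2 I h
    · intro u
      rw [hw2 u, hM3 u]; simp

lemma aux_indep [Fintype Z] [∀ z, Fintype (R z)] (Rstar : Finset (∀ z, R z))
    (P : ∀ z, R z → ℝ) (hP0 : ∀ z r, 0 ≤ P z r)
    (h : ∀ I : Finset ((z : Z) × R z), SGMaxIndep Rstar I → ∑ v ∈ I, P v.1 v.2 ≤ 1)
    (I : Finset ((z : Z) × R z)) (hI : SGIndep Rstar I) : ∑ v ∈ I, P v.1 v.2 ≤ 1 := by
  obtain ⟨J, hIJ, hJ⟩ := Finite.exists_le_maximal (p := SGIndep Rstar) hI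
  refine le_trans (Finset.sum_le_sum_of_subset_of_nonneg hIJ fun v _ _ => hP0 _ _) (h J ⟨hJ.1, ?_⟩)
  intro K hK hJK
  exact le_antisymm (hJ.2 hK hJK) hJK

lemma aux_nat [Fintype Z] [∀ z, Fintype (R z)]
    (Rstar : Finset (∀ z, R z))
    (hperfect : ∀ W : Finset ((z : Z) × R z), SGChrom Rstar W = SGCliqueNum Rstar W)
    (hmaxclique : ∀ C : Finset ((z : Z) × R z), SGMaxClique Rstar C →
      ∃ g ∈ Rstar, C = Finset.univ.image fun z => (⟨z, g z⟩ : (z : Z) × R z))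
    (P : ∀ z, R z → ℝ)
    (hI : ∀ I : Finset ((z : Z) × R z), SGIndep Rstar I → ∑ v ∈ I, P v.1 v.2 ≤ 1)
    (w : ((z : Z) × R z) → ℕ) (k : ℕ) (hk : ∀ g ∈ Rstar, ∑ z, w ⟨z, g z⟩ ≤ k) :
    ∑ v, (w v : ℝ) * P v.1 v.2 ≤ k := by
  have hC : ∀ C, SGClique Rstar C → ∑ v ∈ C, w v ≤ k := by
    intro C hC
    obtain ⟨D, hCD, hD⟩ := Finite.exists_le_maximal (p := SGClique Rstar) hC
    obtain ⟨g, hg, hgD⟩ := hmaxclique D ⟨hD.1, fun K hK hJK => le_antisymm (hD.2 hK hJK) hJK⟩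
    refine le_trans (Finset.sum_le_sum_of_subset hCD) ?_
    rw [hgD, Finset.sum_image]
    · exact hk g hg
    · intro a _ b _ hab
      exact congrArg Sigma.fst hab
  obtain ⟨L, hL1, hL2, hL3⟩ := aux_weighted Rstar hperfect _ w k rfl hC
  have key : ∑ v, (w v : ℝ) * P v.1 v.2 = (L.map (fun I => ∑ v ∈ I, P v.1 v.2)).sum := by
    have : ∀ v, (w v : ℝ) = (L.map (fun I => if v ∈ I then (1 : ℝ) else 0)).sum := by
      intro v
      rw [hL3 v, Nat.cast_multiset_sum, Multiset.map_map]
      congr 1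
      refine Multiset.map_congr rfl fun I _ => ?_
      simp
    simp_rw [this, ← Multiset.sum_map_mul_right]
    rw [← aux_swap L Finset.univ]
    congr 1
    refine Multiset.map_congr rfl fun I _ => ?_
    simp
  rw [key, ← hL1]
  refine le_trans (Multiset.sum_le_card_nsmul _ 1 ?_) (by simp)
  intro x hx
  obtain ⟨I, hIL, rfl⟩ := Multiset.mem_map.1 hx
  exact hI I (hL2 I hIL)

lemma aux_real [Fintype Z] [∀ z, Fintype (R z)]
    (Rstar : Finset (∀ z, R z)) (hRstar : Rstar.Nonempty)
    (hperfect : ∀ W : Finset ((z : Z) × R z), SGChrom Rstar W = SGCliqueNum Rstar W)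
    (hmaxclique : ∀ C : Finset ((z : Z) × R z), SGMaxClique Rstar C →
      ∃ g ∈ Rstar, C = Finset.univ.image fun z => (⟨z, g z⟩ : (z : Z) × R z))
    (P : ∀ z, R z → ℝ) (hP0 : ∀ z r, 0 ≤ P z r)
    (hI : ∀ I : Finset ((z : Z) × R z), SGIndep Rstar I → ∑ v ∈ I, P v.1 v.2 ≤ 1)
    (w : ((z : Z) × R z) → ℝ) (hw : ∀ v, 0 ≤ w v)
    (M : ℝ) (hM : ∀ g ∈ Rstar, ∑ z, w ⟨z, g z⟩ ≤ M) :
    ∑ v, w v * P v.1 v.2 ≤ M := by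
  have hM0 : 0 ≤ M := by
    obtain ⟨g, hg⟩ := hRstar
    exact le_trans (Finset.sum_nonneg fun z _ => hw _) (hM g hg)
  have key : ∀ n : ℕ, (n : ℝ) * (∑ v, w v * P v.1 v.2 - M) ≤ Fintype.card Z := by
    intro n
    have hpos : 0 ≤ (n : ℝ) * M + Fintype.card Z := by positivity
    have h1 := aux_nat Rstar hperfect hmaxclique P hI (fun v => ⌈(n : ℝ) * w v⌉₊)
      ⌊(n : ℝ) * M + Fintype.card Z⌋₊ (by
        intro g hg
        apply Nat.le_floor
        push_cast
        calc ∑ z, ((⌈(n : ℝ) * w ⟨z, g z⟩⌉₊ : ℕ) : ℝ) ≤ ∑ z, ((n : ℝ) * w ⟨z, g z⟩ + 1) :=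
              Finset.sum_le_sum fun z _ =>
                (Nat.ceil_lt_add_one (mul_nonneg (Nat.cast_nonneg _) (hw _))).le
          _ = n * ∑ z, w ⟨z, g z⟩ + Fintype.card Z := by
              rw [Finset.sum_add_distrib, Finset.mul_sum]; simp
          _ ≤ _ := by
              have := mul_le_mul_of_nonneg_left (hM g hg) (Nat.cast_nonneg (α := ℝ) n)
              linarith)
    have h2 := Nat.floor_le hpos
    have h3 : (n : ℝ) * ∑ v, w v * P v.1 v.2
        ≤ ∑ v : (z : Z) × R z, ((⌈(n : ℝ) * w v⌉₊ : ℕ) : ℝ) * P v.1 v.2 := by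
      rw [Finset.mul_sum]
      refine Finset.sum_le_sum fun v _ => ?_
      rw [← mul_assoc]
      exact mul_le_mul_of_nonneg_right (Nat.le_ceil _) (hP0 _ _)
    linarith
  by_contra hcon
  push Not at hcon
  obtain ⟨n, hn⟩ := exists_nat_gt ((Fintype.card Z : ℝ) / (∑ v, w v * P v.1 v.2 - M))
  rw [div_lt_iff₀ (by linarith)] at hn
  exact absurd (key n) (not_le.2 hn)

/-- Assume the potential response graph `G` is perfect and every
maximal clique of `G` equals `C(r*) = {(r*_z, z) : z ∈ Z}` for some `r* ∈ ℛ*`.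
Then a family `(P_z)` of pmf's on the sets `R_z` arises as the marginals of a
probability distribution `Q` on `∏_z R_z` with `Q(ℛ*) = 1` if and only if
`∑_{(r,z) ∈ I} P_z(r) ≤ 1` for every maximal independent set `I` of `G`. -/
theorem stmt_4 [Fintype Z] [Nonempty Z] [∀ z, Fintype (R z)] [∀ z, Nonempty (R z)]
    (Rstar : Finset (∀ z, R z)) (hRstar : Rstar.Nonempty)
    (hperfect : ∀ W : Finset ((z : Z) × R z), SGChrom Rstar W = SGCliqueNum Rstar W)
    (hmaxclique : ∀ C : Finset ((z : Z) × R z), SGMaxClique Rstar C →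
      ∃ g ∈ Rstar, C = Finset.univ.image fun z => (⟨z, g z⟩ : (z : Z) × R z))
    (P : ∀ z, R z → ℝ)
    (hP0 : ∀ z r, 0 ≤ P z r)
    (hP1 : ∀ z, ∑ r : R z, P z r = 1) :
    (∃ Q : (∀ z, R z) → ℝ,
        (∀ g, 0 ≤ Q g) ∧
        (∑ g : ∀ z, R z, Q g = 1) ∧
        (∑ g ∈ Rstar, Q g = 1) ∧
        ∀ (z : Z) (r : R z),
          P z r = ∑ g ∈ Finset.univ.filter (fun g : ∀ z, R z => g z = r), Q g)
    ↔ ∀ I : Finset ((z : Z) × R z), SGMaxIndep Rstar I → ∑ v ∈ I, P v.1 v.2 ≤ 1 := by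
  constructor
  · rintro ⟨Q, hQ0, hQ1, hQR, hQP⟩ I hI
    have hzero : ∀ g, g ∉ Rstar → Q g = 0 := by
      intro g hg
      have h := Finset.sum_add_sum_compl Rstar Q
      have h0 : ∑ g ∈ Rstarᶜ, Q g = 0 := by linarith
      exact (Finset.sum_eq_zero_iff_of_nonneg (fun g _ => hQ0 g)).1 h0 g (by simpa using hg)
    calc ∑ v ∈ I, P v.1 v.2
        = ∑ v ∈ I, ∑ g : ∀ z, R z, (if g v.1 = v.2 then Q g else 0) := by
          refine Finset.sum_congr rfl fun v _ => ?_
          rw [hQP, Finset.sum_filter]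
      _ = ∑ g : ∀ z, R z, ∑ v ∈ I, (if g v.1 = v.2 then Q g else 0) := Finset.sum_comm
      _ ≤ ∑ g : ∀ z, R z, Q g := by
          refine Finset.sum_le_sum fun g _ => ?_
          by_cases hg : g ∈ Rstar
          · rw [← Finset.sum_filter, Finset.sum_const]
            have : (I.filter (fun v => g v.1 = v.2)).card ≤ 1 := by
              rw [Finset.card_le_one]
              intro a ha b hb
              rw [Finset.mem_filter] at ha hb
              by_contra hab
              exact hI.1 a ha.1 b hb.1 ⟨hab, g, hg, ha.2, hb.2⟩
            rw [nsmul_eq_mul]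
            have h' : ((I.filter (fun v => g v.1 = v.2)).card : ℝ) ≤ 1 := by exact_mod_cast this
            nlinarith [hQ0 g]
          · simp [hzero g hg]
      _ = 1 := hQ1
  · intro h
    have hI := aux_indep Rstar P hP0 h
    let T : ((∀ z, R z) → ℝ) →ₗ[ℝ] (((z : Z) × R z) → ℝ) :=
      { toFun := fun Q v => ∑ g : ∀ z, R z, (if g v.1 = v.2 then Q g else 0)
        map_add' := by
          intro x y
          funext v
          simp only [Pi.add_apply, ← Finset.sum_add_distrib]
          refine Finset.sum_congr rfl fun g _ => ?_
          split_ifs <;> simp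
        map_smul' := by
          intro c x
          funext v
          simp [Finset.mul_sum] }
    let A : Set ((∀ z, R z) → ℝ) := stdSimplex ℝ (∀ z, R z) ∩ {Q | ∀ g, g ∉ Rstar → Q g = 0}
    have hAc : IsCompact A := by
      apply (isCompact_stdSimplex ℝ (∀ z, R z)).inter_right
      simp only [Set.ofPred_forall]
      refine isClosed_iInter fun g => isClosed_iInter fun _ => ?_
      exact isClosed_eq (continuous_apply g) continuous_const
    have hAconv : Convex ℝ A := by
      apply (convex_stdSimplex ℝ (∀ z, R z)).inter
      intro x hx y hy a b _ _ _ g hg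
      simp [hx g hg, hy g hg]
    have hK : IsClosed (T '' A) :=
      (hAc.image (LinearMap.continuous_of_finiteDimensional T)).isClosed
    have hKc : Convex ℝ (T '' A) := hAconv.linear_image T
    have hmem : (fun v : (z : Z) × R z => P v.1 v.2) ∈ T '' A := by
      by_contra hx
      obtain ⟨f, u, hfu, hux⟩ := geometric_hahn_banach_closed_point hKc hK hx
      let w : ((z : Z) × R z) → ℝ := fun v => f (Pi.single v 1)
      have hf : ∀ y, f y = ∑ v, w v * y v := by
        intro y
        conv_lhs => rw [pi_eq_sum_univ' y]
        rw [map_sum]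
        refine Finset.sum_congr rfl fun v _ => ?_
        rw [map_smul, smul_eq_mul, mul_comm]
      let c : ℝ := ∑ v, |w v|
      have hc : ∀ v, 0 ≤ w v + c := by
        intro v
        have h1 : |w v| ≤ c :=
          Finset.single_le_sum (f := fun v => |w v|) (fun _ _ => abs_nonneg _) (Finset.mem_univ v)
        have := neg_abs_le (w v)
        linarith
      have hg : ∀ g ∈ Rstar, ∑ z, w ⟨z, g z⟩ < u := by
        intro g hg
        have h1 := hfu (T (Pi.single g 1)) ⟨_, ⟨single_mem_stdSimplex ℝ g, by
          intro g' hg'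
          have : g' ≠ g := fun h => hg' (h ▸ hg)
          simp [this]⟩, rfl⟩
        rw [hf] at h1
        refine lt_of_eq_of_lt ?_ h1
        have h2 : ∀ v : (z : Z) × R z, T (Pi.single g 1) v = if g v.1 = v.2 then 1 else 0 := by
          intro v
          change ∑ g' : ∀ z, R z, (if g' v.1 = v.2 then (Pi.single g 1 : (∀ z, R z) → ℝ) g' else 0) = _
          rw [Finset.sum_eq_single g]
          · simp
          · intro b _ hb
            simp [hb]
          · simp
        simp_rw [h2]
        rw [Fintype.sum_sigma]
        simp
      have h3 := aux_real Rstar hRstar hperfect hmaxclique P hP0 hI (fun v => w v + c) hc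
        (u + c * Fintype.card Z) (by
          intro g hgR
          rw [Finset.sum_add_distrib]
          have := hg g hgR
          simp
          linarith)
      have h4 : ∑ v : (z : Z) × R z, (w v + c) * P v.1 v.2
          = ∑ v : (z : Z) × R z, w v * P v.1 v.2 + c * Fintype.card Z := by
        simp_rw [add_mul]
        rw [Finset.sum_add_distrib, ← Finset.mul_sum]
        congr 2
        rw [Fintype.sum_sigma]
        simp [hP1]
      rw [hf] at hux
      linarith
    obtain ⟨Q, ⟨⟨hQ0, hQ1⟩, hQR⟩, hQP⟩ := hmem
    refine ⟨Q, hQ0, hQ1, ?_, ?_⟩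
    · rw [← hQ1]
      exact Finset.sum_subset (Finset.subset_univ _) fun g _ hg => hQR g hg
    · intro z r
      rw [Finset.sum_filter]
      exact (congrFun hQP ⟨z, r⟩).symm
end

section
/- Let (P_z)_{z∈𝒵} be a family of probability measures on 𝒴 × 𝒟. Then the following are equivalent: (a) there exists a probability measure Q on ℛ* such that for every z ∈ 𝒵 the pushforward of Q under the map (Y,D) ↦ (Y(D(z)), D(z)) equals P_z; (b) for every admissible tuple {(B_{ℓ,d})_{ℓ∈S_d}}_{d∈𝒟} one has ∑_{d∈𝒟} ∑_{ℓ∈S_d} P_{z_ℓ}(B_{ℓ,d} × {d}) ≤ 1. -/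
open MeasureTheory
open scoped Classical


lemma aux_cover {D : Type*} [Fintype D] [LinearOrder D] (b : D → ℝ) (x : ℝ)
    (hx : 0 < x) (hx' : x ≤ ∑ d, b d) :
    ∃ d, ∑ e with e < d, b e < x ∧ x ≤ (∑ e with e < d, b e) + b d := by
  have key : ∀ d, (∑ e with e < d, b e) + b d = ∑ e with e ≤ d, b e := by
    intro d
    have : (Finset.univ.filter (fun e : D => e ≤ d)) =
        insert d (Finset.univ.filter (fun e : D => e < d)) := by
      ext e; simp [le_iff_eq_or_lt]
    rw [this, Finset.sum_insert (by simp), add_comm]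
  have hne : (Finset.univ : Finset D).Nonempty := by
    by_contra h
    rw [Finset.not_nonempty_iff_eq_empty] at h
    rw [h] at hx'; simp at hx'; linarith
  have hT : (Finset.univ.filter (fun d => x ≤ ∑ e with e ≤ d, b e)).Nonempty := by
    refine ⟨Finset.univ.max' hne, ?_⟩
    have : (Finset.univ.filter (fun e : D => e ≤ Finset.univ.max' hne)) = Finset.univ := by
      ext e; simp [Finset.le_max']
    simp only [Finset.mem_filter, Finset.mem_univ, true_and, this]; exact hx'
  set d0 := Finset.min' _ hT with hd0
  have h0 := Finset.min'_mem _ hT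
  rw [← hd0] at h0
  simp only [Finset.mem_filter, Finset.mem_univ, true_and] at h0
  refine ⟨d0, ?_, by rw [key]; exact h0⟩
  by_contra! hc
  have hU : (Finset.univ.filter (fun e : D => e < d0)).Nonempty := by
    by_contra h
    rw [Finset.not_nonempty_iff_eq_empty] at h
    rw [h] at hc; simp at hc; linarith
  set d1 := Finset.max' _ hU with hd1
  have h1 := Finset.max'_mem _ hU
  rw [← hd1] at h1
  simp only [Finset.mem_filter, Finset.mem_univ, true_and] at h1
  have : (Finset.univ.filter (fun e : D => e < d0)) = Finset.univ.filter (fun e : D => e ≤ d1) := by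
    ext e
    simp only [Finset.mem_filter, Finset.mem_univ, true_and]
    exact ⟨fun h => Finset.le_max' _ _ (by simpa using h), fun h => lt_of_le_of_lt h h1⟩
  rw [this] at hc
  have := Finset.min'_le (Finset.univ.filter (fun d => x ≤ ∑ e with e ≤ d, b e)) d1 (by simpa using hc)
  exact absurd (lt_of_le_of_lt this h1) (lt_irrefl _)

lemma aux_lt {D : Type*} [Fintype D] [LinearOrder D] (b : D → ℝ) (hb : ∀ d, 0 ≤ b d)
    {d d' : D} (h : d < d') : (∑ e with e < d, b e) + b d ≤ ∑ e with e < d', b e := by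
  have : insert d (Finset.univ.filter (fun e : D => e < d)) ⊆
      (Finset.univ.filter (fun e : D => e < d')) := by
    intro e; simp only [Finset.mem_insert, Finset.mem_filter, Finset.mem_univ, true_and]
    rintro (rfl | h1)
    · exact h
    · exact h1.trans h
  have h2 := Finset.sum_le_sum_of_subset_of_nonneg this (fun i _ _ => hb i)
  rw [Finset.sum_insert (by simp)] at h2
  linarith

def auxI {D : Type*} [Fintype D] [LinearOrder D] (b : D → ℝ) (d : D) : Set ℝ :=
  Set.Ioc (∑ e with e < d, b e) ((∑ e with e < d, b e) + b d)

lemma auxI_disj {D : Type*} [Fintype D] [LinearOrder D] (b : D → ℝ) (hb : ∀ d, 0 ≤ b d) :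
    Pairwise (fun d d' => Disjoint (auxI b d) (auxI b d')) := by
  intro d d' hne
  rw [Set.disjoint_left]
  rintro x ⟨h1, h2⟩ ⟨h3, h4⟩
  rcases lt_or_gt_of_ne hne with h | h
  · have := aux_lt b hb h; linarith
  · have := aux_lt b hb h; linarith

lemma auxI_sum {D : Type*} [Fintype D] [LinearOrder D] (a b : D → ℝ)
    (ha : ∀ d, 0 ≤ a d) (hb : ∀ d, 0 ≤ b d) (hab : ∑ d, a d = ∑ d, b d) (d : D) :
    ∑ d', volume (auxI a d ∩ auxI b d') = ENNReal.ofReal (a d) := by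
  have h1 : auxI a d = ⋃ d' ∈ Finset.univ, auxI a d ∩ auxI b d' := by
    ext x
    simp only [Set.mem_iUnion, Finset.mem_univ, exists_prop, true_and, Set.mem_inter_iff]
    constructor
    · intro hx
      have h0 : 0 ≤ ∑ e with e < d, a e := Finset.sum_nonneg (fun i _ => ha i)
      have h2 : (∑ e with e < d, a e) + a d ≤ ∑ e, a e := by
        have := Finset.sum_le_sum_of_subset_of_nonneg
          (Finset.subset_univ (insert d (Finset.univ.filter (fun e : D => e < d))))
          (fun i _ _ => ha i)
        rw [Finset.sum_insert (by simp)] at this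
        linarith
      obtain ⟨d', h3, h4⟩ := aux_cover b x (lt_of_le_of_lt h0 hx.1) (by rw [← hab]; exact hx.2.trans h2)
      exact ⟨d', hx, h3, h4⟩
    · rintro ⟨_, h, _⟩; exact h
  rw [← measure_biUnion_finset, ← h1]
  · simp [auxI]
  · intro i _ j _ hij
    exact (auxI_disj b hb hij).mono Set.inter_subset_right Set.inter_subset_right
  · intro i _
    exact measurableSet_Ioc.inter measurableSet_Ioc

lemma aux_discrete {D : Type*} [Fintype D] [LinearOrder D] (a b : D → ℝ)
    (ha : ∀ d, 0 ≤ a d) (hb : ∀ d, 0 ≤ b d) (hab : ∑ d, a d = ∑ d, b d)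
    (hdom : ∀ d, (∑ e with e < d, b e) + b d ≤ ∑ e with e < d, a e) :
    ∃ γ : D → D → ENNReal, (∀ d, ∑ d', γ d d' = ENNReal.ofReal (a d)) ∧
      (∀ d', ∑ d, γ d d' = ENNReal.ofReal (b d')) ∧ ∀ d d', ¬ d < d' → γ d d' = 0 := by
  refine ⟨fun d d' => volume (auxI a d ∩ auxI b d'), auxI_sum a b ha hb hab, ?_, ?_⟩
  · intro d'
    exact (Finset.sum_congr rfl (fun d _ => by rw [Set.inter_comm])).trans
      (auxI_sum b a hb ha hab.symm d')
  · intro d d' h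
    have : auxI a d ∩ auxI b d' = ∅ := by
      rw [Set.eq_empty_iff_forall_notMem]
      rintro x ⟨⟨h1, h2⟩, h3, h4⟩
      have h5 := hdom d'
      have h6 : ∑ e with e < d', a e ≤ ∑ e with e < d, a e := by
        rcases (not_lt.1 h).eq_or_lt with rfl | h7
        · exact le_rfl
        · have := aux_lt a ha h7; linarith [ha d']
      linarith
    simp [this]

open ProbabilityTheory in
lemma aux_chain {X : Type*} [MeasurableSpace X] [StandardBorelSpace X] [Nonempty X]
    (R : X → X → Prop) (hR : MeasurableSet {p : X × X | R p.1 p.2})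
    (P : ℕ → Measure X) (hP : ∀ i, IsProbabilityMeasure (P i)) (n : ℕ)
    (hc : ∀ i < n, ∃ π : Measure (X × X), π.fst = P i ∧ π.snd = P (i + 1) ∧
      ∀ᵐ p ∂π, R p.1 p.2) :
    ∃ Q : Measure (ℕ → X), IsProbabilityMeasure Q ∧ (∀ i ≤ n, Q.map (fun ω => ω i) = P i) ∧
      ∀ i < n, ∀ᵐ ω ∂Q, R (ω i) (ω (i + 1)) := by
  induction n with
  | zero =>
    have hm : Measurable (fun x : X => fun _ : ℕ => x) := by fun_prop
    refine ⟨(P 0).map (fun x _ => x), Measure.isProbabilityMeasure_map hm.aemeasurable, ?_, by simp⟩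
    intro i hi
    obtain rfl : i = 0 := by omega
    rw [Measure.map_map (by fun_prop) hm]
    exact Measure.map_id
  | succ n ih =>
    obtain ⟨Q, hQ, hQm, hQR⟩ := ih (fun i hi => hc i (by omega))
    obtain ⟨π, h1, h2, h3⟩ := hc n (by omega)
    have hpi : IsProbabilityMeasure π := by
      constructor
      have := (hP n).measure_univ
      rw [← h1, Measure.fst_univ] at this
      exact this
    have hev : Measurable (fun ω : ℕ → X => ω n) := by fun_prop
    set η : Kernel (ℕ → X) X := π.condKernel.comap (fun ω => ω n) hev with hη
    set ρ := Q ⊗ₘ η with hρ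
    have hfst : ρ.map Prod.fst = Q := Measure.fst_compProd Q η
    have hpair : ρ.map (fun p => (p.1 n, p.2)) = π := by
      have hd := π.disintegrate π.condKernel
      rw [h1, ← hQm n le_rfl] at hd
      rw [← hd]
      ext s hs
      rw [Measure.map_apply (by fun_prop) hs, hρ, Measure.compProd_apply
        (by exact (by fun_prop : Measurable (fun p : (ℕ → X) × X => (p.1 n, p.2))) hs),
        Measure.compProd_apply hs, lintegral_map _ hev]
      · rfl
      · exact Kernel.measurable_kernel_prodMk_left hs
    have hu : Measurable (fun p : (ℕ → X) × X => Function.update p.1 (n + 1) p.2) := by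
      rw [measurable_pi_iff]
      intro i
      by_cases h : i = n + 1
      · subst h; simpa using measurable_snd
      · simp only [Function.update_of_ne h]; fun_prop
    refine ⟨ρ.map (fun p => Function.update p.1 (n + 1) p.2),
      Measure.isProbabilityMeasure_map hu.aemeasurable, ?_, ?_⟩
    · intro i hi
      rw [Measure.map_map (by fun_prop) hu]
      by_cases h : i = n + 1
      · subst h
        have : ((fun ω : ℕ → X => ω (n + 1)) ∘ fun p : (ℕ → X) × X => Function.update p.1 (n + 1) p.2)
            = Prod.snd ∘ (fun p : (ℕ → X) × X => (p.1 n, p.2)) := by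
          ext p; simp
        rw [this, ← Measure.map_map measurable_snd (by fun_prop), hpair]
        exact h2
      · have : ((fun ω : ℕ → X => ω i) ∘ fun p : (ℕ → X) × X => Function.update p.1 (n + 1) p.2)
            = (fun ω : ℕ → X => ω i) ∘ Prod.fst := by
          ext p; simp [Function.update_of_ne h]
        rw [this, ← Measure.map_map (by fun_prop) measurable_fst, hfst]
        exact hQm i (by omega)
    · intro i hi
      rw [ae_map_iff hu.aemeasurable
        (by exact (by fun_prop : Measurable (fun ω : ℕ → X => (ω i, ω (i + 1)))) hR)]
      by_cases h : i = n
      · subst h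
        rw [← hpair] at h3
        filter_upwards [ae_of_ae_map (by fun_prop) h3] with p hp
        simpa using hp
      · have h4 := hQR i (by omega)
        rw [← hfst] at h4
        filter_upwards [ae_of_ae_map (by fun_prop) h4] with p hp
        rw [Function.update_of_ne (by omega), Function.update_of_ne (by omega)]
        exact hp

lemma aux_restrict_sum {Y D : Type*} [MeasurableSpace Y] [MeasurableSpace D] [Fintype D]
    [DiscreteMeasurableSpace D] (α : Measure (Y × D)) :
    ∑ d, α.restrict {x | x.2 = d} = α := by
  ext s hs
  rw [Measure.finsetSum_apply]
  have hm : ∀ d : D, MeasurableSet {x : Y × D | x.2 = d} := fun d =>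
    measurable_snd (MeasurableSet.of_discrete (s := ({d} : Set D)))
  have : s = ⋃ d ∈ (Finset.univ : Finset D), s ∩ {x | x.2 = d} := by
    ext x; simp
  conv_rhs => rw [this]
  rw [measure_biUnion_finset]
  · simp [Measure.restrict_apply hs]
  · intro i _ j _ hij
    rw [Function.onFun, Set.disjoint_left]
    rintro x ⟨_, h1⟩ ⟨_, h2⟩
    exact hij (h1.symm.trans h2)
  · intro d _; exact hs.inter (hm d)

lemma aux_measure_filter {Y D : Type*} [MeasurableSpace Y] [MeasurableSpace D] [Fintype D]
    [DiscreteMeasurableSpace D] (α : Measure (Y × D)) [IsFiniteMeasure α] (p : D → Prop) [DecidablePred p] :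
    ∑ d with p d, α.real {x | x.2 = d} = α.real {x | p x.2} := by
  have hm : ∀ d : D, MeasurableSet {x : Y × D | x.2 = d} := fun d =>
    measurable_snd (MeasurableSet.of_discrete (s := ({d} : Set D)))
  rw [← measureReal_biUnion_finset]
  · congr 1; ext x; simp
  · intro i _ j _ hij
    rw [Function.onFun, Set.disjoint_left]
    rintro x h1 h2
    exact hij (h1.symm.trans h2)
  · intro d _; exact hm d

lemma aux_couple {Y D : Type*} [MeasurableSpace Y] [MeasurableSpace D] [Fintype D] [LinearOrder D]
    [DiscreteMeasurableSpace D] (α β : Measure (Y × D)) [IsFiniteMeasure α] [IsFiniteMeasure β]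
    (hab : α Set.univ = β Set.univ)
    (hdom : ∀ d, β {x | x.2 ≤ d} ≤ α {x | x.2 < d}) :
    ∃ π : Measure ((Y × D) × (Y × D)), π.fst = α ∧ π.snd = β ∧ ∀ᵐ p ∂π, p.1.2 < p.2.2 := by
  have hm : ∀ d : D, MeasurableSet {x : Y × D | x.2 = d} := fun d =>
    measurable_snd (MeasurableSet.of_discrete (s := ({d} : Set D)))
  obtain ⟨γ, h1, h2, h3⟩ := aux_discrete (fun d => α.real {x | x.2 = d})
    (fun d => β.real {x | x.2 = d}) (fun d => measureReal_nonneg) (fun d => measureReal_nonneg)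
    (by
      have e1 := aux_measure_filter α (fun _ => True)
      have e2 := aux_measure_filter β (fun _ => True)
      simp only [Finset.filter_true, Set.ofPred_true] at e1 e2
      rw [e1, e2, Measure.real, hab, Measure.real])
    (by
      intro d
      rw [aux_measure_filter α (fun e => e < d)]
      have : (∑ e with e < d, β.real {x | x.2 = e}) + β.real {x | x.2 = d}
          = ∑ e with e ≤ d, β.real {x | x.2 = e} := by
        have : (Finset.univ.filter (fun e : D => e ≤ d)) =
            insert d (Finset.univ.filter (fun e : D => e < d)) := by
          ext e; simp [le_iff_eq_or_lt]
        rw [this, Finset.sum_insert (by simp), add_comm]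
      rw [this, aux_measure_filter β (fun e => e ≤ d)]
      exact ENNReal.toReal_mono (measure_ne_top _ _) (hdom d))
  replace h1 : ∀ d, ∑ d', γ d d' = α {x | x.2 = d} := fun d =>
    (h1 d).trans (ENNReal.ofReal_toReal (measure_ne_top _ _))
  replace h2 : ∀ d', ∑ d, γ d d' = β {x | x.2 = d'} := fun d =>
    (h2 d).trans (ENNReal.ofReal_toReal (measure_ne_top _ _))
  set A : D → Measure (Y × D) := fun d => α.restrict {x | x.2 = d} with hA
  set B : D → Measure (Y × D) := fun d => β.restrict {x | x.2 = d} with hB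
  have hAu : ∀ d, A d Set.univ = α {x | x.2 = d} := fun d => by simp [hA]
  have hBu : ∀ d, B d Set.univ = β {x | x.2 = d} := fun d => by simp [hB]
  have g1 : ∀ d d', α {x | x.2 = d} = 0 → γ d d' = 0 := by
    intro d d' h
    have := h1 d
    rw [h, Finset.sum_eq_zero_iff] at this
    exact this d' (Finset.mem_univ _)
  have g2 : ∀ d d', β {x | x.2 = d'} = 0 → γ d d' = 0 := by
    intro d d' h
    have := h2 d'
    rw [h, Finset.sum_eq_zero_iff] at this
    exact this d (Finset.mem_univ _)
  set c : D → D → ENNReal := fun d d' =>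
    γ d d' * ((α {x | x.2 = d})⁻¹ * (β {x | x.2 = d'})⁻¹) with hc
  have c1 : ∀ d d', c d d' * β {x | x.2 = d'} = γ d d' * (α {x | x.2 = d})⁻¹ := by
    intro d d'
    by_cases h : β {x | x.2 = d'} = 0
    · simp [hc, g2 d d' h]
    · simp only [hc]
      rw [mul_assoc, mul_assoc, ENNReal.inv_mul_cancel h (measure_ne_top _ _), mul_one]
  have c2 : ∀ d d', c d d' * α {x | x.2 = d} = γ d d' * (β {x | x.2 = d'})⁻¹ := by
    intro d d'
    by_cases h : α {x | x.2 = d} = 0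
    · simp [hc, g1 d d' h]
    · simp only [hc]
      rw [mul_comm (α {x | x.2 = d})⁻¹, mul_assoc, mul_assoc,
        ENNReal.inv_mul_cancel h (measure_ne_top _ _), mul_one]
  refine ⟨∑ d, ∑ d', c d d' • (A d).prod (B d'), ?_, ?_, ?_⟩
  · conv_rhs => rw [← aux_restrict_sum α]
    ext s hs
    rw [Measure.fst_apply hs]
    simp only [Measure.finsetSum_apply, Measure.smul_apply, smul_eq_mul]
    refine Finset.sum_congr rfl fun d _ => ?_
    have : ∀ d', c d d' * ((A d).prod (B d')) (Prod.fst ⁻¹' s)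
        = γ d d' * ((α {x | x.2 = d})⁻¹ * A d s) := by
      intro d'
      rw [← Set.prod_univ, Measure.prod_prod, hBu, mul_comm (A d s), ← mul_assoc, c1, mul_assoc]
    simp only [this]
    rw [← Finset.sum_mul, h1]
    by_cases h : α {x | x.2 = d} = 0
    · rw [h, zero_mul]
      exact (measure_mono_null (Set.subset_univ s) ((hAu d).trans h)).symm
    · rw [← mul_assoc, ENNReal.mul_inv_cancel h (measure_ne_top _ _), one_mul]
  · conv_rhs => rw [← aux_restrict_sum β]
    ext s hs
    rw [Measure.snd_apply hs]
    simp only [Measure.finsetSum_apply, Measure.smul_apply, smul_eq_mul]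
    rw [Finset.sum_comm]
    refine Finset.sum_congr rfl fun d' _ => ?_
    have : ∀ d, c d d' * ((A d).prod (B d')) (Prod.snd ⁻¹' s)
        = γ d d' * ((β {x | x.2 = d'})⁻¹ * B d' s) := by
      intro d
      rw [← Set.univ_prod, Measure.prod_prod, hAu, ← mul_assoc, c2, mul_assoc]
    simp only [this]
    rw [← Finset.sum_mul, h2]
    by_cases h : β {x | x.2 = d'} = 0
    · rw [h, zero_mul]
      exact (measure_mono_null (Set.subset_univ s) ((hBu d').trans h)).symm
    · rw [← mul_assoc, ENNReal.mul_inv_cancel h (measure_ne_top _ _), one_mul]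
  · rw [ae_iff]
    simp only [Measure.finsetSum_apply, Measure.smul_apply, smul_eq_mul]
    refine Finset.sum_eq_zero fun d _ => Finset.sum_eq_zero fun d' _ => ?_
    by_cases h : d < d'
    · rw [mul_eq_zero]; right
      have ha : ∀ᵐ x ∂(A d), x.2 = d := ae_restrict_mem (hm d)
      have hb : ∀ᵐ x ∂(B d'), x.2 = d' := ae_restrict_mem (hm d')
      have ha' := Measure.quasiMeasurePreserving_fst (μ := A d) (ν := B d') |>.ae ha
      have hb' := Measure.quasiMeasurePreserving_snd (μ := A d) (ν := B d') |>.ae hb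
      rw [← ae_iff]
      filter_upwards [ha', hb'] with p h1 h2
      rw [h1, h2]; exact h
    · simp [hc, h3 d d' h]

lemma aux_couple2 {Y D : Type*} [MeasurableSpace Y] [StandardBorelSpace Y]
    [MeasurableSpace D] [Fintype D] [LinearOrder D]
    [DiscreteMeasurableSpace D] (P P' : Measure (Y × D)) [IsProbabilityMeasure P]
    [IsProbabilityMeasure P']
    (hdom : ∀ (s : Set (Y × D)) (d : D), MeasurableSet s →
      P' ({x | x.2 < d} ∪ (sᶜ ∩ {x | x.2 = d})) ≤ P ({x | x.2 < d} ∪ (sᶜ ∩ {x | x.2 = d}))) :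
    ∃ π : Measure ((Y × D) × (Y × D)), π.fst = P ∧ π.snd = P' ∧
      ∀ᵐ p ∂π, p.1 = p.2 ∨ p.1.2 < p.2.2 := by
  obtain ⟨s, hs, h1, h2⟩ := hahn_decomposition P P'
  have hm : ∀ p : D → Prop, MeasurableSet {x : Y × D | p x.2} := fun p =>
    measurable_snd (MeasurableSet.of_discrete (s := {d | p d}))
  set m := P'.restrict s + P.restrict sᶜ with hmdef
  have split : ∀ (μ : Measure (Y × D)) t, μ (t ∩ s) + μ (t ∩ sᶜ) = μ t := fun μ t => by
    rw [← Set.sdiff_eq]; exact measure_inter_add_sdiff t hs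
  have mle : m ≤ P := by
    rw [Measure.le_iff]
    intro t ht
    rw [hmdef, Measure.add_apply, Measure.restrict_apply ht, Measure.restrict_apply ht,
      ← split P t]
    gcongr 1
    exact h1 _ (ht.inter hs) Set.inter_subset_right
  have mle' : m ≤ P' := by
    rw [Measure.le_iff]
    intro t ht
    rw [hmdef, Measure.add_apply, Measure.restrict_apply ht, Measure.restrict_apply ht,
      ← split P' t]
    gcongr 1
    exact h2 _ (ht.inter hs.compl) Set.inter_subset_right
  have hα : P - m + m = P := Measure.sub_add_cancel_of_le mle
  have hβ : P' - m + m = P' := Measure.sub_add_cancel_of_le mle'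
  have hα0 : (P - m) sᶜ = 0 := by
    rw [Measure.sub_apply hs.compl mle]
    simp [hmdef, Measure.restrict_apply hs.compl]
  have hβ0 : (P' - m) s = 0 := by
    rw [Measure.sub_apply hs mle']
    simp [hmdef, Measure.restrict_apply hs]
  have hle : P - m ≤ P := Measure.sub_le
  have hle' : P' - m ≤ P' := Measure.sub_le
  have : IsFiniteMeasure (P - m) := isFiniteMeasure_of_le P hle
  have : IsFiniteMeasure (P' - m) := isFiniteMeasure_of_le P' hle'
  obtain ⟨π, k1, k2, k3⟩ := aux_couple (P - m) (P' - m)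
    (by rw [Measure.sub_apply .univ mle, Measure.sub_apply .univ mle']; simp)
    (by
      intro d
      set T : Set (Y × D) := {x | x.2 < d} ∪ (sᶜ ∩ {x | x.2 = d}) with hT
      have hTm : MeasurableSet T := (hm (· < d)).union (hs.compl.inter (hm (· = d)))
      have e : (P' - m) T ≤ (P - m) T := by
        rw [Measure.sub_apply hTm mle, Measure.sub_apply hTm mle']
        exact tsub_le_tsub_right (hdom s d hs) _
      calc (P' - m) {x | x.2 ≤ d} ≤ (P' - m) (T ∪ s) := by
            apply measure_mono
            intro x hx
            rcases (show x.2 ≤ d from hx).lt_or_eq with h | h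
            · exact Or.inl (Or.inl h)
            · by_cases hxs : x ∈ s
              · exact Or.inr hxs
              · exact Or.inl (Or.inr ⟨hxs, h⟩)
        _ ≤ (P' - m) T + (P' - m) s := measure_union_le _ _
        _ ≤ (P - m) T := by rw [hβ0, add_zero]; exact e
        _ ≤ (P - m) ({x | x.2 < d} ∪ sᶜ) := measure_mono
            (Set.union_subset_union_right _ Set.inter_subset_left)
        _ ≤ (P - m) {x | x.2 < d} + (P - m) sᶜ := measure_union_le _ _
        _ = (P - m) {x | x.2 < d} := by rw [hα0, add_zero])
  have hdiag : Measurable (fun x : Y × D => (x, x)) := by fun_prop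
  refine ⟨π + m.map (fun x => (x, x)), ?_, ?_, ?_⟩
  · rw [Measure.fst_add, k1, Measure.fst, Measure.map_map measurable_fst hdiag]
    simpa [Function.comp_def] using hα
  · rw [Measure.snd_add, k2, Measure.snd, Measure.map_map measurable_snd hdiag]
    simpa [Function.comp_def] using hβ
  · rw [ae_add_measure_iff]
    refine ⟨k3.mono fun p hp => Or.inr hp, ?_⟩
    have : MeasurableSet {p : (Y × D) × (Y × D) | p.1 = p.2 ∨ p.1.2 < p.2.2} :=
      (measurableSet_eq_fun measurable_fst measurable_snd).union
        ((by fun_prop : Measurable (fun p : (Y × D) × (Y × D) => (p.1.2, p.2.2)))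
          (MeasurableSet.of_discrete (s := {q : D × D | q.1 < q.2})))
    rw [ae_map_iff hdiag.aemeasurable this]
    simp

def auxG {Y D : Type*} [DecidableEq D] (y0 : Y) (d : D) : ℕ → (ℕ → Y × D) → Y
  | 0, _ => y0
  | n + 1, ω => if (ω n).2 = d then (ω n).1 else auxG y0 d n ω

lemma auxG_meas {Y D : Type*} [MeasurableSpace Y] [MeasurableSpace D] [DecidableEq D]
    [DiscreteMeasurableSpace D] (y0 : Y) (d : D) (n : ℕ) :
    Measurable (auxG (Y := Y) y0 d n) := by
  induction n with
  | zero => exact measurable_const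
  | succ n ih =>
    refine Measurable.ite ?_ (by fun_prop) ih
    exact (by fun_prop : Measurable (fun ω : ℕ → Y × D => (ω n).2))
      (MeasurableSet.of_discrete (s := ({d} : Set D)))

lemma aux_trans {Y D : Type*} [LinearOrder D] (ω : ℕ → Y × D) (n : ℕ)
    (h : ∀ i < n, ω i = ω (i + 1) ∨ (ω i).2 < (ω (i + 1)).2) (i j : ℕ) (hij : i ≤ j) (hj : j ≤ n) :
    ω i = ω j ∨ (ω i).2 < (ω j).2 := by
  induction j, hij using Nat.le_induction with
  | base => exact Or.inl rfl
  | succ j hij ih =>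
    rcases ih (by omega) with h1 | h1 <;> rcases h j (by omega) with h2 | h2
    · exact Or.inl (h1.trans h2)
    · right; rw [h1]; exact h2
    · right; rw [← h2]; exact h1
    · right; exact h1.trans h2

lemma auxG_eq {Y D : Type*} [LinearOrder D] (y0 : Y) (ω : ℕ → Y × D) (n : ℕ)
    (h : ∀ i < n, ω i = ω (i + 1) ∨ (ω i).2 < (ω (i + 1)).2) (m : ℕ) (hm : m ≤ n + 1)
    (z : ℕ) (hz : z < m) : auxG y0 (ω z).2 m ω = (ω z).1 := by
  induction m with
  | zero => omega
  | succ m ih =>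
    rw [auxG]
    split_ifs with hd
    · rcases aux_trans ω n h z m (by omega) (by omega) with h1 | h1
      · rw [h1]
      · rw [hd] at h1; exact absurd h1 (lt_irrefl _)
    · have : z ≠ m := by rintro rfl; exact hd rfl
      exact ih (by omega) (by omega)

lemma aux_ev_meas {Y D : Type*} [MeasurableSpace Y] [Fintype D]
    [MeasurableSpace D] [DiscreteMeasurableSpace D] {K : ℕ} (z : Fin K) :
    Measurable (fun p : (D → Y) × (Fin K → D) => (p.1 (p.2 z), p.2 z)) := by
  have h2 : Measurable (fun p : (D → Y) × (Fin K → D) => p.2 z) := by fun_prop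
  refine Measurable.prodMk ?_ h2
  intro t ht
  have : (fun p : (D → Y) × (Fin K → D) => p.1 (p.2 z)) ⁻¹' t
      = ⋃ d : D, {p | p.2 z = d} ∩ {p | p.1 d ∈ t} := by
    ext p; simp
  rw [this]
  refine MeasurableSet.iUnion fun d => MeasurableSet.inter ?_ ?_
  · exact h2 (MeasurableSet.of_discrete (s := ({d} : Set D)))
  · exact (by fun_prop : Measurable (fun p : (D → Y) × (Fin K → D) => p.1 d)) ht

lemma aux_forward
    {Y : Type*} [MeasurableSpace Y]
    {D : Type*} [Fintype D] [LinearOrder D]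
    [MeasurableSpace D] [DiscreteMeasurableSpace D]
    {K : ℕ} (P : Fin K → Measure (Y × D))
    (Q : Measure ((D → Y) × (Fin K → D))) [IsProbabilityMeasure Q]
    (hQ : Q {p : (D → Y) × (Fin K → D) | Monotone p.2} = 1)
    (hQP : ∀ z : Fin K, Q.map (fun p => (p.1 (p.2 z), p.2 z)) = P z)
    (S : D → Finset (Fin K)) (B : Fin K → D → Set Y)
    (hSne : ∀ d, (S d).Nonempty)
    (hBm : ∀ d, ∀ ℓ ∈ S d, MeasurableSet (B ℓ d))
    (hBd : ∀ d, ∀ ℓ ∈ S d, ∀ ℓ' ∈ S d, ℓ ≠ ℓ' → Disjoint (B ℓ d) (B ℓ' d))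
    (hS : ∀ d d' : D, d < d' → (S d').max' (hSne d') ≤ (S d).min' (hSne d)) :
    ∑ d : D, ∑ ℓ ∈ S d, P ℓ (B ℓ d ×ˢ ({d} : Set D)) ≤ 1 := by
  have hmono : MeasurableSet {p : (D → Y) × (Fin K → D) | Monotone p.2} :=
    measurable_snd (MeasurableSet.of_discrete (s := {f : Fin K → D | Monotone f}))
  have hmono0 : Q {p : (D → Y) × (Fin K → D) | Monotone p.2}ᶜ = 0 := by
    rw [prob_compl_eq_zero_iff hmono]; exact hQ
  set E : (Σ _ : D, Fin K) → Set ((D → Y) × (Fin K → D)) := fun i =>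
    (fun p => (p.1 (p.2 i.2), p.2 i.2)) ⁻¹' (B i.2 i.1 ×ˢ ({i.1} : Set D)) with hE
  have hms : ∀ d, ∀ ℓ ∈ S d, MeasurableSet (B ℓ d ×ˢ ({d} : Set D)) := fun d ℓ h =>
    (hBm d ℓ h).prod .of_discrete
  rw [Finset.sum_sigma' Finset.univ S (fun d ℓ => P ℓ (B ℓ d ×ˢ ({d} : Set D)))]
  have : ∀ i ∈ Finset.univ.sigma S, P i.2 (B i.2 i.1 ×ˢ ({i.1} : Set D)) = Q (E i) := by
    rintro ⟨d, ℓ⟩ hi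
    simp only [Finset.mem_sigma, Finset.mem_univ, true_and] at hi
    rw [← hQP, Measure.map_apply (aux_ev_meas ℓ) (hms d ℓ hi)]
  rw [Finset.sum_congr rfl this, ← measure_biUnion_finset₀]
  · exact prob_le_one
  · have main : ∀ d ℓ d' ℓ', ℓ ∈ S d → ℓ' ∈ S d' → d < d' →
        ∀ p ∈ E ⟨d, ℓ⟩, p ∈ E ⟨d', ℓ'⟩ → ¬ Monotone p.2 := by
      rintro d ℓ d' ℓ' h1 h2 h3 p ⟨_, h4⟩ ⟨_, h5⟩ hp
      have h6 : ℓ' ≤ ℓ := ((S d').le_max' _ h2).trans ((hS d d' h3).trans ((S d).min'_le _ h1))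
      have h7 := hp h6
      simp only [Set.mem_singleton_iff] at h4 h5
      rw [h4, h5] at h7
      exact absurd h3 (not_lt.2 h7)
    rintro ⟨d, ℓ⟩ hi ⟨d', ℓ'⟩ hj hij
    simp only [Finset.coe_sigma, Set.mem_sigma_iff, Finset.coe_univ, Set.mem_univ, true_and,
      Finset.mem_coe] at hi hj
    refine measure_mono_null ?_ hmono0
    rintro p ⟨h1, h2⟩
    rcases lt_trichotomy d d' with h | h | h
    · exact main d ℓ d' ℓ' hi hj h p h1 h2
    · subst h
      exfalso
      have hne : ℓ ≠ ℓ' := by rintro rfl; exact hij rfl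
      obtain ⟨h3, h4⟩ := h1
      obtain ⟨h5, h6⟩ := h2
      simp only [Set.mem_singleton_iff] at h3 h4 h5 h6
      rw [h4] at h3
      rw [h6] at h5
      exact Set.disjoint_left.1 (hBd d ℓ hi ℓ' hj hne) h3 h5
    · exact main d' ℓ' d ℓ hj hi h p h2 h1
  · rintro ⟨d, ℓ⟩ hi
    simp only [Finset.mem_sigma, Finset.mem_univ, true_and] at hi
    exact (aux_ev_meas ℓ (hms d ℓ hi)).nullMeasurableSet

lemma aux_dom
    {Y : Type*} [MeasurableSpace Y]
    {D : Type*} [Fintype D] [LinearOrder D]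
    [MeasurableSpace D] [DiscreteMeasurableSpace D]
    {K : ℕ} (P : Fin K → Measure (Y × D))
    (hP : ∀ ℓ, IsProbabilityMeasure (P ℓ))
    (H : ∀ (S : D → Finset (Fin K)) (B : Fin K → D → Set Y)
        (hSne : ∀ d, (S d).Nonempty),
        (∀ d, ∀ ℓ ∈ S d, MeasurableSet (B ℓ d)) →
        (∀ d, ∀ ℓ ∈ S d, ∀ ℓ' ∈ S d, ℓ ≠ ℓ' → Disjoint (B ℓ d) (B ℓ' d)) →
        (∀ d, ⋃ ℓ ∈ S d, B ℓ d = Set.univ) →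
        (∀ d d' : D, d < d' → (S d').max' (hSne d') ≤ (S d).min' (hSne d)) →
        ∑ d : D, ∑ ℓ ∈ S d, P ℓ (B ℓ d ×ˢ ({d} : Set D)) ≤ 1)
    (a b : Fin K) (hab : a < b) (s : Set (Y × D)) (d : D) (hs : MeasurableSet s) :
    P b ({x | x.2 < d} ∪ (sᶜ ∩ {x | x.2 = d})) ≤ P a ({x | x.2 < d} ∪ (sᶜ ∩ {x | x.2 = d})) := by
  have hm : ∀ p : D → Prop, MeasurableSet {x : Y × D | p x.2} := fun p =>
    measurable_snd (MeasurableSet.of_discrete (s := {d | p d}))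
  set T : Set (Y × D) := {x | x.2 < d} ∪ (sᶜ ∩ {x | x.2 = d}) with hT
  have hTm : MeasurableSet T := (hm (· < d)).union (hs.compl.inter (hm (· = d)))
  -- the tuple
  let S : D → Finset (Fin K) := fun e => if e < d then {b} else if e = d then {a, b} else {a}
  let B : Fin K → D → Set Y := fun ℓ e => if ℓ = b then {y | (y, e) ∈ T} else {y | (y, e) ∉ T}
  have hBb : ∀ e, B b e = {y | (y, e) ∈ T} := fun e => by simp [B]
  have hBa : ∀ e, B a e = {y | (y, e) ∉ T} := fun e => by simp [B, hab.ne]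
  have hTlt : ∀ e, e < d → ∀ y, (y, e) ∈ T := fun e he y => Or.inl he
  have hTgt : ∀ e, d < e → ∀ y, (y, e) ∉ T := by
    rintro e he y (h | h)
    · exact lt_asymm he h
    · exact he.ne' h.2
  have hSsub : ∀ e, ∀ ℓ ∈ S e, ℓ = a ∨ ℓ = b := by
    intro e ℓ h
    simp only [S] at h
    split_ifs at h <;> simp at h <;> tauto
  have hSne : ∀ e, (S e).Nonempty := by
    intro e; simp only [S]; split_ifs <;> simp
  have hsec : ∀ e, MeasurableSet {y | (y, e) ∈ T} := fun e =>
    (by fun_prop : Measurable (fun y : Y => (y, e))) hTm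
  have key : ∑ e : D, ∑ ℓ ∈ S e, P ℓ (B ℓ e ×ˢ ({e} : Set D)) = P b T + P a Tᶜ := by
    have h1 : ∀ e, ∑ ℓ ∈ S e, P ℓ (B ℓ e ×ˢ ({e} : Set D)) =
        (P b).restrict {x | x.2 = e} T + (P a).restrict {x | x.2 = e} Tᶜ := by
      intro e
      have e1 : (P b).restrict {x | x.2 = e} T = P b (B b e ×ˢ ({e} : Set D)) := by
        rw [Measure.restrict_apply hTm, hBb]
        congr 1
        ext ⟨y, f⟩
        simp only [Set.mem_inter_iff, Set.mem_ofPred_eq, Set.mem_prod, Set.mem_singleton_iff]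
        constructor
        · rintro ⟨h, rfl⟩; exact ⟨h, rfl⟩
        · rintro ⟨h, rfl⟩; exact ⟨h, rfl⟩
      have e2 : (P a).restrict {x | x.2 = e} Tᶜ = P a (B a e ×ˢ ({e} : Set D)) := by
        rw [Measure.restrict_apply hTm.compl, hBa]
        congr 1
        ext ⟨y, f⟩
        simp only [Set.mem_inter_iff, Set.mem_ofPred_eq, Set.mem_prod, Set.mem_singleton_iff,
          Set.mem_compl_iff]
        constructor
        · rintro ⟨h, rfl⟩; exact ⟨h, rfl⟩
        · rintro ⟨h, rfl⟩; exact ⟨h, rfl⟩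
      rw [e1, e2]
      rcases lt_trichotomy e d with h | h | h
      · have : B a e = ∅ := by
          rw [hBa, Set.eq_empty_iff_forall_notMem]
          intro y hy; exact hy (hTlt e h y)
        simp [S, h, this]
      · simp [S, h, Finset.sum_pair hab.ne, add_comm]
      · have : B b e = ∅ := by
          rw [hBb, Set.eq_empty_iff_forall_notMem]
          intro y hy; exact hTgt e h y hy
        simp [S, h.not_gt, h.ne', this]
    simp only [h1]
    rw [Finset.sum_add_distrib, ← Measure.finsetSum_apply, ← Measure.finsetSum_apply,
      aux_restrict_sum, aux_restrict_sum]
  have hfin := H S B hSne ?_ ?_ ?_ ?_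
  · rw [key] at hfin
    have h1 : P a T + P a Tᶜ = 1 := by
      rw [measure_add_measure_compl hTm]; exact (hP a).measure_univ
    rw [← h1] at hfin
    have := hP a
    exact (ENNReal.add_le_add_iff_right (measure_ne_top (P a) _)).1 hfin
  · intro e ℓ hℓ
    rcases hSsub e ℓ hℓ with rfl | rfl
    · rw [hBa]; exact (hsec e).compl
    · rw [hBb]; exact hsec e
  · intro e ℓ hℓ ℓ' hℓ' hne
    rw [Set.disjoint_left]
    rcases hSsub e ℓ hℓ with rfl | rfl <;> rcases hSsub e ℓ' hℓ' with rfl | rfl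
    · exact absurd rfl hne
    · rw [hBa, hBb]; exact fun y h1 h2 => h1 h2
    · rw [hBa, hBb]; exact fun y h1 h2 => h2 h1
    · exact absurd rfl hne
  · intro e
    rw [Set.eq_univ_iff_forall]
    intro y
    simp only [Set.mem_iUnion, exists_prop]
    by_cases hy : (y, e) ∈ T
    · refine ⟨b, ?_, by rw [hBb]; exact hy⟩
      have : ¬ d < e := fun h => hTgt e h y hy
      rcases (not_lt.1 this).lt_or_eq with h | h
      · simp [S, h]
      · simp [S, h]
    · refine ⟨a, ?_, by rw [hBa]; exact hy⟩
      have : ¬ e < d := fun h => hy (hTlt e h y)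
      by_cases h : e = d <;> simp [S, h, this]
  · intro e e' hee
    rw [Finset.max'_le_iff]
    intro ℓ' hℓ'
    rw [Finset.le_min'_iff]
    intro ℓ hℓ
    rcases lt_or_ge e d with h | h
    · have : ℓ = b := by simpa [S, h] using hℓ
      rw [this]
      rcases hSsub e' ℓ' hℓ' with rfl | rfl
      · exact hab.le
      · exact le_rfl
    · have h' : d < e' := lt_of_le_of_lt h hee
      have : ℓ' = a := by simpa [S, h'.not_gt, h'.ne'] using hℓ'
      rw [this]
      rcases hSsub e ℓ hℓ with rfl | rfl
      · exact le_rfl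
      · exact hab.le

/-- Sharp testable implications of exclusion and monotonicity with
multivalued treatments and instruments.  Here `𝒴` is a standard Borel space, `𝒟` a
nonempty finite linearly ordered set (discrete), and `𝒵 = Fin K` (so `z_ℓ = ℓ`).
`ℛ*` is the set of pairs `(Y, D)` with `Y : 𝒟 → 𝒴` and `D : 𝒵 → 𝒟` monotone.
A family of probability measures `(P_z)` on `𝒴 × 𝒟` arises as the distributions of
`(Y(D(z)), D(z))` under some probability measure `Q` with `Q(ℛ*) = 1` if and only if
for every admissible tuple `{(B_{ℓ,d})_{ℓ ∈ S_d}}_{d ∈ 𝒟}` one has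
`∑_d ∑_{ℓ ∈ S_d} P_ℓ(B_{ℓ,d} × {d}) ≤ 1`. -/
theorem stmt_5
    {Y : Type*} [MeasurableSpace Y] [StandardBorelSpace Y]
    {D : Type*} [Fintype D] [LinearOrder D] [Nonempty D]
    [MeasurableSpace D] [DiscreteMeasurableSpace D]
    {K : ℕ} (hK : 0 < K)
    (P : Fin K → Measure (Y × D))
    (hP : ∀ ℓ, IsProbabilityMeasure (P ℓ)) :
    (∃ Q : Measure ((D → Y) × (Fin K → D)),
        IsProbabilityMeasure Q ∧
        Q {p : (D → Y) × (Fin K → D) | Monotone p.2} = 1 ∧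
        ∀ z : Fin K, Q.map (fun p => (p.1 (p.2 z), p.2 z)) = P z)
    ↔ ∀ (S : D → Finset (Fin K)) (B : Fin K → D → Set Y)
        (hSne : ∀ d, (S d).Nonempty),
        (∀ d, ∀ ℓ ∈ S d, MeasurableSet (B ℓ d)) →
        (∀ d, ∀ ℓ ∈ S d, ∀ ℓ' ∈ S d, ℓ ≠ ℓ' → Disjoint (B ℓ d) (B ℓ' d)) →
        (∀ d, ⋃ ℓ ∈ S d, B ℓ d = Set.univ) →
        (∀ d d' : D, d < d' → (S d').max' (hSne d') ≤ (S d).min' (hSne d)) →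
        ∑ d : D, ∑ ℓ ∈ S d, P ℓ (B ℓ d ×ˢ ({d} : Set D)) ≤ 1 := by
  constructor
  · rintro ⟨Q, hQ1, hQ2, hQ3⟩ S B hSne hBm hBd _ hS
    exact aux_forward P Q hQ2 hQ3 S B hSne hBm hBd hS
  · intro H
    obtain ⟨n, rfl⟩ : ∃ n, K = n + 1 := ⟨K - 1, by omega⟩
    have hX : Nonempty (Y × D) := by
      have := hP 0
      exact (P 0).nonempty_of_neZero
    obtain ⟨y0, _⟩ := id hX
    let P' : ℕ → Measure (Y × D) := fun i => P ⟨min i n, by omega⟩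
    have hP' : ∀ i (h : i < n + 1), P' i = P ⟨i, h⟩ := by
      intro i h
      simp only [P']
      congr 2
      omega
    have hPr : ∀ i, IsProbabilityMeasure (P' i) := fun i => hP _
    have hRm : MeasurableSet {p : (Y × D) × (Y × D) | p.1 = p.2 ∨ p.1.2 < p.2.2} :=
      (measurableSet_eq_fun measurable_fst measurable_snd).union
        ((by fun_prop : Measurable (fun p : (Y × D) × (Y × D) => (p.1.2, p.2.2)))
          (MeasurableSet.of_discrete (s := {q : D × D | q.1 < q.2})))
    obtain ⟨μ, hμ, hμP, hμR⟩ := aux_chain (fun x x' : Y × D => x = x' ∨ x.2 < x'.2) hRm P' hPr n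
      (by
        intro i hi
        apply aux_couple2
        intro s d hs
        rw [hP' i (by omega), hP' (i + 1) (by omega)]
        exact aux_dom P hP H _ _ (by simp [Fin.lt_def]) s d hs)
    have hΦ : Measurable (fun ω : ℕ → Y × D =>
        ((fun d => auxG y0 d (n + 1) ω, fun z => (ω z).2) : (D → Y) × (Fin (n + 1) → D))) := by
      refine Measurable.prodMk ?_ (by fun_prop)
      exact measurable_pi_iff.2 fun d => auxG_meas y0 d (n + 1)
    have hall : ∀ᵐ ω ∂μ, ∀ i < n, ω i = ω (i + 1) ∨ (ω i).2 < (ω (i + 1)).2 := by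
      rw [ae_all_iff]; intro i
      by_cases hi : i < n
      · filter_upwards [hμR i hi] with ω h _ using h
      · exact Filter.Eventually.of_forall fun ω h => absurd h hi
    have hpr : IsProbabilityMeasure (μ.map (fun ω : ℕ → Y × D =>
        ((fun d => auxG y0 d (n + 1) ω, fun z => (ω z).2) : (D → Y) × (Fin (n + 1) → D)))) :=
      Measure.isProbabilityMeasure_map hΦ.aemeasurable
    refine ⟨_, hpr, ?_, ?_⟩
    · have hmono : MeasurableSet {p : (D → Y) × (Fin (n + 1) → D) | Monotone p.2} :=
        measurable_snd (MeasurableSet.of_discrete (s := {f : Fin (n + 1) → D | Monotone f}))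
      rw [← prob_compl_eq_zero_iff hmono]
      refine (ae_iff (p := fun p : (D → Y) × (Fin (n + 1) → D) => Monotone p.2)).1 ?_
      rw [ae_map_iff hΦ.aemeasurable hmono]
      filter_upwards [hall] with ω h i j hij
      rcases aux_trans ω n h i j hij (by omega) with h1 | h1
      · exact (congrArg Prod.snd h1).le
      · exact h1.le
    · intro z
      rw [Measure.map_map (aux_ev_meas z) hΦ]
      rw [← hP' z z.2, ← hμP z (by omega)]
      apply Measure.map_congr
      filter_upwards [hall] with ω h
      simp only [Function.comp]
      rw [auxG_eq y0 ω n h (n + 1) le_rfl z z.2]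
end

section
/- Suppose 𝒟 = {0,1} and 𝒵 = {z_1 < z_2}, and suppose the inequalities ∑_{d∈𝒟} ∑_{ℓ∈S_d} P_{z_ℓ}(B_{ℓ,d} × {d}) ≤ 1 hold for every admissible tuple. Then for every measurable set A ⊆ 𝒴 one has P_{z_1}(A × {1}) ≤ P_{z_2}(A × {1}) and P_{z_2}(A × {0}) ≤ P_{z_1}(A × {0}). -/
open MeasureTheory
open scoped Classical

theorem total_aux {Y : Type*} [MeasurableSpace Y] (μ : Measure (Y × Fin 2))
    [IsProbabilityMeasure μ] (A : Set Y) (hA : MeasurableSet A) (d e : Fin 2) (hde : d ≠ e) :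
    μ (Set.univ ×ˢ ({e} : Set (Fin 2))) + μ (Aᶜ ×ˢ ({d} : Set (Fin 2)))
      + μ (A ×ˢ ({d} : Set (Fin 2))) = 1 := by
  have hd : MeasurableSet ({d} : Set (Fin 2)) := MeasurableSet.singleton d
  rw [add_assoc, ← measure_union _ (hA.prod hd), ← measure_union]
  · rw [← measure_univ (μ := μ)]
    congr 1
    ext ⟨y, c⟩
    have : c = e ∨ c = d := by omega
    by_cases y ∈ A <;> simp_all
  · rw [Set.disjoint_left]
    rintro ⟨y, c⟩
    simp only [Set.mem_prod, Set.mem_singleton_iff, Set.mem_union]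
    rintro ⟨_, rfl⟩ (⟨_, h⟩ | ⟨_, h⟩) <;> exact hde h.symm
  · exact (hA.compl.prod hd).union (hA.prod hd)
  · rw [Set.disjoint_left]
    rintro ⟨y, c⟩
    simp only [Set.mem_prod, Set.mem_compl_iff]
    tauto

set_option maxHeartbeats 2000000

/-- Specialization to binary treatment and binary instrument:
`𝒟 = Fin 2 = {0,1}` and `𝒵 = Fin 2 = {z_1 < z_2}` (so `z_1 = 0`, `z_2 = 1`).
If the admissible-tuple inequalities
`∑_d ∑_{ℓ ∈ S_d} P_{z_ℓ}(B_{ℓ,d} × {d}) ≤ 1` hold for every admissible tuple, then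
for every measurable `A ⊆ 𝒴`,
`P_{z_1}(A × {1}) ≤ P_{z_2}(A × {1})` and `P_{z_2}(A × {0}) ≤ P_{z_1}(A × {0})`. -/
theorem stmt_6
    {Y : Type*} [MeasurableSpace Y]
    (P : Fin 2 → Measure (Y × Fin 2))
    (hP : ∀ ℓ, IsProbabilityMeasure (P ℓ))
    (hineq : ∀ (S : Fin 2 → Finset (Fin 2)) (B : Fin 2 → Fin 2 → Set Y)
        (hSne : ∀ d, (S d).Nonempty),
        (∀ d, ∀ ℓ ∈ S d, MeasurableSet (B ℓ d)) →
        (∀ d, ∀ ℓ ∈ S d, ∀ ℓ' ∈ S d, ℓ ≠ ℓ' → Disjoint (B ℓ d) (B ℓ' d)) →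
        (∀ d, ⋃ ℓ ∈ S d, B ℓ d = Set.univ) →
        (∀ d d' : Fin 2, d < d' → (S d').max' (hSne d') ≤ (S d).min' (hSne d)) →
        ∑ d : Fin 2, ∑ ℓ ∈ S d, P ℓ (B ℓ d ×ˢ ({d} : Set (Fin 2))) ≤ 1)
    (A : Set Y) (hA : MeasurableSet A) :
    P 0 (A ×ˢ ({1} : Set (Fin 2))) ≤ P 1 (A ×ˢ ({1} : Set (Fin 2))) ∧
    P 1 (A ×ˢ ({0} : Set (Fin 2))) ≤ P 0 (A ×ˢ ({0} : Set (Fin 2))) := by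
  constructor
  · have h := hineq ![{1}, {0, 1}] ![![∅, A], ![Set.univ, Aᶜ]]
      (by intro d; fin_cases d <;> simp)
      (by intro d l; fin_cases d <;> fin_cases l <;> simp [hA])
      (by
        intro d l hl l' hl' hne
        fin_cases d <;> fin_cases l <;> fin_cases l' <;>
          simp_all [disjoint_compl_right, disjoint_compl_left])
      (by intro d; fin_cases d <;> simp)
      (by
        intro d d' hd
        fin_cases d <;> fin_cases d' <;> simp at hd ⊢ <;> decide)
    have := hP 1
    have ht := total_aux (P 1) A hA 1 0 (by decide)
    rw [← ht] at h
    simp [Fin.sum_univ_two] at h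
    rw [add_comm (P 0 _), ← add_assoc] at h
    exact (ENNReal.add_le_add_iff_left (by finiteness)).1 h
  · have h := hineq ![{0, 1}, {0}] ![![Aᶜ, Set.univ], ![A, ∅]]
      (by intro d; fin_cases d <;> simp)
      (by intro d l; fin_cases d <;> fin_cases l <;> simp [hA])
      (by
        intro d l hl l' hl' hne
        fin_cases d <;> fin_cases l <;> fin_cases l' <;>
          simp_all [disjoint_compl_right, disjoint_compl_left])
      (by intro d; fin_cases d <;> simp)
      (by
        intro d d' hd
        fin_cases d <;> fin_cases d' <;> simp at hd ⊢)
    have := hP 0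
    have ht := total_aux (P 0) A hA 0 1 (by decide)
    rw [← ht] at h
    simp [Fin.sum_univ_two] at h
    rw [add_comm _ (P 0 (Set.univ ×ˢ _)), ← add_assoc] at h
    exact (ENNReal.add_le_add_iff_left (by finiteness)).1 h
end

section
/- Let Q be a probability measure on the space of pairs (Y, D) with Y : 𝒟 → 𝒴 and D : 𝒵 → 𝒟. Fix d ∈ 𝒟, an integer L ≥ 1, pairwise disjoint measurable sets B_1, …, B_L ⊆ 𝒴, and pairwise distinct points z_1, …, z_L ∈ 𝒵. Then ∑_{ℓ=1}^{L} Q({(Y,D) : Y(d) ∈ B_ℓ and D(z_ℓ) = d}) ≤ 1. -/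
open MeasureTheory
open scoped Classical

/-- Testable implication of the exclusion restriction.  Let `Q` be a
probability measure on the space of pairs `(Y, D)` with `Y : 𝒟 → 𝒴` and
`D : 𝒵 → 𝒟` (product σ-algebra; `𝒟, 𝒵` discrete).  Fix `d ∈ 𝒟`, `L ≥ 1`,
pairwise disjoint measurable sets `B_1, …, B_L ⊆ 𝒴` and pairwise distinct points
`z_1, …, z_L ∈ 𝒵`.  Then
`∑_{ℓ=1}^{L} Q({(Y,D) : Y(d) ∈ B_ℓ ∧ D(z_ℓ) = d}) ≤ 1`. -/
theorem stmt_7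
    {Y : Type*} [MeasurableSpace Y]
    {D Z : Type*} [Fintype D] [Fintype Z] [Nonempty D] [Nonempty Z]
    [MeasurableSpace D] [DiscreteMeasurableSpace D]
    (Q : Measure ((D → Y) × (Z → D))) [IsProbabilityMeasure Q]
    (d : D) (L : ℕ) (hL : 1 ≤ L)
    (B : Fin L → Set Y)
    (hBmeas : ∀ ℓ, MeasurableSet (B ℓ))
    (hBdisj : ∀ ℓ ℓ' : Fin L, ℓ ≠ ℓ' → Disjoint (B ℓ) (B ℓ'))
    (z : Fin L → Z) (hz : Function.Injective z) :
    ∑ ℓ : Fin L, Q {p : (D → Y) × (Z → D) | p.1 d ∈ B ℓ ∧ p.2 (z ℓ) = d} ≤ 1 := by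
  have hm : ∀ ℓ : Fin L,
      MeasurableSet {p : (D → Y) × (Z → D) | p.1 d ∈ B ℓ ∧ p.2 (z ℓ) = d} := by
    intro ℓ
    have h1 : Measurable (fun p : (D → Y) × (Z → D) => p.1 d) :=
      (measurable_pi_apply d).comp measurable_fst
    have h2 : Measurable (fun p : (D → Y) × (Z → D) => p.2 (z ℓ)) :=
      (measurable_pi_apply (z ℓ)).comp measurable_snd
    exact (h1 (hBmeas ℓ)).inter (h2 (MeasurableSet.of_discrete (s := {d})))
  rw [← measure_univ (μ := Q)]
  refine sum_measure_le_measure_univ (fun ℓ _ => (hm ℓ).nullMeasurableSet) ?_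
  intro a _ b _ hab
  refine Disjoint.aedisjoint ?_
  rw [Set.disjoint_left]
  rintro p ⟨ha, _⟩ ⟨hb, _⟩
  exact Set.disjoint_left.mp (hBdisj a b hab) ha hb
end

section
/- Let Q be a probability measure on the functions X → 𝓡 (with the product σ-algebra) satisfying Q(ℛ*) = 1. Then for every independent set I of the graph G — in particular for every maximal independent set of G — one has ∑_{(s,z)∈I} Q({r* : T(r*,z) ∈ A_{s,z}}) ≤ 1. -/
open MeasureTheory
open scoped Classical

/-- General-outcome version of the MIS inequalities.  `𝓡` is a
measurable space, `X, Z` nonempty finite sets, `T` has measurable sections,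
`ℛ*` is a measurable set of admissible types, and for each `z` the sets
`(A_{s,z})_{s ∈ S_z}` form a finite measurable partition of `𝓡`.  If `Q` is a
probability measure on `X → 𝓡` with `Q(ℛ*) = 1`, then for every independent set `I`
of the graph `G` (in particular every maximal independent set),
`∑_{(s,z) ∈ I} Q({r* : T(r*,z) ∈ A_{s,z}}) ≤ 1`. -/
theorem stmt_8
    {𝓡 : Type*} [MeasurableSpace 𝓡]
    {X Z : Type*} [Fintype X] [Fintype Z] [Nonempty X] [Nonempty Z]
    (T : (X → 𝓡) → Z → 𝓡)
    (hT : ∀ z, Measurable fun f : X → 𝓡 => T f z)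
    (Rstar : Set (X → 𝓡)) (hRmeas : MeasurableSet Rstar)
    {S : Z → Type*} [∀ z, Fintype (S z)]
    (A : (z : Z) → S z → Set 𝓡)
    (hAmeas : ∀ z s, MeasurableSet (A z s))
    (hAdisj : ∀ z, ∀ s t : S z, s ≠ t → Disjoint (A z s) (A z t))
    (hAcover : ∀ z, (⋃ s : S z, A z s) = Set.univ)
    (Q : Measure (X → 𝓡)) [IsProbabilityMeasure Q]
    (hQsupp : Q Rstar = 1)
    (I : Finset ((z : Z) × S z))
    -- `I` is an independent set: no two distinct vertices of `I` are adjacent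
    (hIindep : ∀ v ∈ I, ∀ w ∈ I, v ≠ w →
      ¬ ∃ rs ∈ Rstar, T rs v.1 ∈ A v.1 v.2 ∧ T rs w.1 ∈ A w.1 w.2) :
    ∑ v ∈ I, Q {f : X → 𝓡 | T f v.1 ∈ A v.1 v.2} ≤ 1 := by
  have hc : Q Rstarᶜ = 0 := (prob_compl_eq_zero_iff hRmeas).2 hQsupp
  have hm : ∀ v : (z : Z) × S z, MeasurableSet {f : X → 𝓡 | T f v.1 ∈ A v.1 v.2} :=
    fun v => hT v.1 (hAmeas v.1 v.2)
  have hd : (I : Set ((z : Z) × S z)).Pairwise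
      (Function.onFun (AEDisjoint Q) fun v => {f : X → 𝓡 | T f v.1 ∈ A v.1 v.2}) := by
    intro v hv w hw hvw
    refine measure_mono_null ?_ hc
    rintro f ⟨h1, h2⟩ hf
    exact hIindep v hv w hw hvw ⟨f, hf, h1, h2⟩
  rw [← measure_biUnion_finset₀ hd (fun v _ => (hm v).nullMeasurableSet)]
  exact prob_le_one
end

section
/- The equality convexHull{1_S : S ∈ 𝒮*} = {P ∈ ℝ^{V_G} : P(v) ≥ 0 for every vertex v, and ∑_{v∈I} P(v) ≤ 1 for every maximal independent set I of G} holds if and only if 𝒞* contains every maximal clique of G and G is perfect. -/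
open scoped Classical

variable {V : Type*}

/-- `I` is an independent set of `G`. -/
def GIndep (G : SimpleGraph V) (I : Finset V) : Prop :=
  ∀ a ∈ I, ∀ b ∈ I, ¬ G.Adj a b

/-- `I` is a maximal independent set of `G`. -/
def GMaxIndep (G : SimpleGraph V) (I : Finset V) : Prop :=
  GIndep G I ∧ ∀ J : Finset V, GIndep G J → I ⊆ J → J = I

/-- `C` is a maximal clique of `G`. -/
def GMaxClique (G : SimpleGraph V) (C : Finset V) : Prop :=
  G.IsClique (C : Set V) ∧ ∀ C' : Finset V, G.IsClique (C' : Set V) → C ⊆ C' → C' = C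

/-- Chromatic number of the subgraph of `G` induced by `W`: the least number of
colors in a proper coloring of `W` (equivalently, the least number of independent
sets needed to partition `W`). -/
noncomputable def GChrom (G : SimpleGraph V) (W : Finset V) : ℕ :=
  sInf {n : ℕ | ∃ c : V → ℕ, (∀ v ∈ W, c v < n) ∧
    ∀ u ∈ W, ∀ v ∈ W, G.Adj u v → c u ≠ c v}

/-- Clique number of the subgraph of `G` induced by `W`: the maximum size of a
clique contained in `W`. -/
noncomputable def GCliqueNum (G : SimpleGraph V) (W : Finset V) : ℕ :=
  sSup {n : ℕ | ∃ C : Finset V, C ⊆ W ∧ G.IsClique (C : Set V) ∧ C.card = n}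

/-- `G` is perfect: for every vertex subset `W`, the chromatic number of the
subgraph induced by `W` equals its clique number. -/
def GPerfect [Fintype V] (G : SimpleGraph V) : Prop :=
  ∀ W : Finset V, GChrom G W = GCliqueNum G W


theorem aux_inter_le_one (G : SimpleGraph V) {C I : Finset V} (hC : G.IsClique (C : Set V))
    (hI : GIndep G I) : (C.filter (fun v => v ∈ I)).card ≤ 1 := by
  rw [Finset.card_le_one]
  intro a ha b hb
  rw [Finset.mem_filter] at ha hb
  by_contra hab
  exact hI a ha.2 b hb.2 (hC (by exact_mod_cast ha.1) (by exact_mod_cast hb.1) hab)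

theorem aux_cliqueNum_bdd [Fintype V] (G : SimpleGraph V) (W : Finset V) :
    BddAbove {n : ℕ | ∃ C : Finset V, C ⊆ W ∧ G.IsClique (C : Set V) ∧ C.card = n} := by
  refine ⟨W.card, ?_⟩
  rintro n ⟨C, hC, -, rfl⟩
  exact Finset.card_le_card hC

theorem aux_cliqueNum_mem [Fintype V] (G : SimpleGraph V) (W : Finset V) :
    ∃ C : Finset V, C ⊆ W ∧ G.IsClique (C : Set V) ∧ C.card = GCliqueNum G W :=
  Nat.sSup_mem (s := {n : ℕ | ∃ C : Finset V, C ⊆ W ∧ G.IsClique (C : Set V) ∧ C.card = n})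
    ⟨0, ∅, by simp, by simp, by simp⟩ (aux_cliqueNum_bdd G W)

theorem aux_le_cliqueNum [Fintype V] (G : SimpleGraph V) {W C : Finset V} (h : C ⊆ W)
    (hC : G.IsClique (C : Set V)) : C.card ≤ GCliqueNum G W :=
  le_csSup (aux_cliqueNum_bdd G W) ⟨C, h, hC, rfl⟩

theorem aux_chrom_mem [Fintype V] (G : SimpleGraph V) (W : Finset V) :
    ∃ c : V → ℕ, (∀ v ∈ W, c v < GChrom G W) ∧
      ∀ u ∈ W, ∀ v ∈ W, G.Adj u v → c u ≠ c v := by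
  refine Nat.sInf_mem (s := {n : ℕ | ∃ c : V → ℕ, (∀ v ∈ W, c v < n) ∧
    ∀ u ∈ W, ∀ v ∈ W, G.Adj u v → c u ≠ c v}) ?_
  refine ⟨Fintype.card V, fun v => (Fintype.equivFin V v : ℕ), fun v _ => Fin.is_lt _, ?_⟩
  intro u _ v _ huv h
  exact huv.ne ((Fintype.equivFin V).injective (Fin.ext h))

/-- Weighted colouring of perfect graphs (replication lemma). -/
theorem aux_weighted_s10 [Fintype V] (G : SimpleGraph V) (hG : GPerfect G) :
    ∀ (n : ℕ) (w : V → ℕ) (k : ℕ), ∑ v, w v = n →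
      (∀ C : Finset V, G.IsClique (C : Set V) → ∑ v ∈ C, w v ≤ k) →
      ∃ f : Fin k → Finset V, (∀ j, GIndep G (f j)) ∧
        ∀ v, w v ≤ ∑ j, if v ∈ f j then 1 else 0 := by
  intro n
  induction n using Nat.strong_induction_on with
  | _ n ih =>
  intro w k hn hk
  by_cases hw : ∀ v, w v ≤ 1
  · set W : Finset V := Finset.univ.filter (fun v => w v = 1) with hW
    obtain ⟨c, hc1, hc2⟩ := aux_chrom_mem G W
    have hle : GChrom G W ≤ k := by
      rw [hG W]
      obtain ⟨C, hCW, hC, hcard⟩ := aux_cliqueNum_mem G W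
      rw [← hcard]
      refine le_trans (le_of_eq ?_) (hk C hC)
      rw [Finset.card_eq_sum_ones]
      refine Finset.sum_congr rfl fun v hv => ?_
      have := hCW hv
      simp [hW] at this
      exact this.symm
    refine ⟨fun j => W.filter (fun v => c v = j), ?_, ?_⟩
    · intro j a ha b hb hab
      rw [Finset.mem_filter] at ha hb
      exact hc2 a ha.1 b hb.1 hab (ha.2.trans hb.2.symm)
    · intro v
      by_cases hv : v ∈ W
      · have h := Finset.single_le_sum (f := fun j : Fin k =>
          if v ∈ W.filter (fun v => c v = j) then 1 else 0) (fun _ _ => Nat.zero_le _)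
          (Finset.mem_univ (⟨c v, lt_of_lt_of_le (hc1 v hv) hle⟩ : Fin k))
        simp only [Finset.mem_filter, hv, true_and, if_true] at h
        refine (hw v).trans ?_
        simpa [hv] using h
      · have : w v = 0 := by
          have h1 := hw v
          have h2 : w v ≠ 1 := by simpa [hW] using hv
          omega
        rw [this]; exact Nat.zero_le _
  · push Not at hw
    obtain ⟨v, hv⟩ := hw
    set w' : V → ℕ := fun x => if x = v then w x - 1 else w x with hw'
    have hle' : ∀ x, w' x ≤ w x := by
      intro x; simp only [hw']; split_ifs <;> omega
    have hlt' : ∑ x, w' x < n := by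
      rw [← hn]
      refine Finset.sum_lt_sum (fun x _ => hle' x) ⟨v, Finset.mem_univ _, ?_⟩
      simp only [hw', if_true]; omega
    obtain ⟨f, hf, hcov⟩ := ih _ hlt' w' k rfl
      (fun C hC => (Finset.sum_le_sum fun x _ => hle' x).trans (hk C hC))
    have hj : ∃ j, v ∈ f j := by
      by_contra hcon
      push Not at hcon
      have := hcov v
      simp only [hcon, if_false, Finset.sum_const_zero, hw', if_true] at this
      omega
    obtain ⟨j, hj⟩ := hj
    obtain ⟨k, rfl⟩ : ∃ k', k = k' + 1 := ⟨k - 1, by have := j.is_lt; omega⟩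
    set w'' : V → ℕ := fun x => if x ≠ v ∧ x ∈ f j then w' x - 1 else w' x with hw''
    have hle'' : ∀ x, w'' x ≤ w' x := by
      intro x; simp only [hw'']; split_ifs <;> omega
    have hlt'' : ∑ x, w'' x < n := (Finset.sum_le_sum fun x _ => hle'' x).trans_lt hlt'
    obtain ⟨g, hg, hgcov⟩ := ih _ hlt'' w'' k rfl (by
      intro C hC
      by_cases hvC : v ∈ C
      · have h1 : ∑ x ∈ C, w' x < ∑ x ∈ C, w x := by
          refine Finset.sum_lt_sum (fun x _ => hle' x) ⟨v, hvC, ?_⟩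
          simp only [hw', if_true]; omega
        have h2 : ∑ x ∈ C, w'' x ≤ ∑ x ∈ C, w' x := Finset.sum_le_sum fun x _ => hle'' x
        have h3 := hk C hC
        omega
      · calc ∑ x ∈ C, w'' x
            ≤ ∑ x ∈ C, ∑ i : Fin k, if x ∈ f (j.succAbove i) then 1 else 0 := by
              refine Finset.sum_le_sum fun x hx => ?_
              have hxv : x ≠ v := fun h => hvC (h ▸ hx)
              have h := hcov x
              rw [Fin.sum_univ_succAbove _ j] at h
              by_cases hxj : x ∈ f j
              · have e : w'' x = w' x - 1 := by simp [hw'', hxv, hxj]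
                rw [if_pos hxj] at h
                omega
              · have e : w'' x = w' x := by simp [hw'', hxj]
                rw [if_neg hxj] at h
                omega
          _ = ∑ i : Fin k, ∑ x ∈ C, if x ∈ f (j.succAbove i) then 1 else 0 := Finset.sum_comm
          _ ≤ ∑ i : Fin k, 1 := by
              refine Finset.sum_le_sum fun i _ => ?_
              rw [← Finset.card_filter]
              exact aux_inter_le_one G hC (hf _)
          _ = k := by simp)
    refine ⟨Fin.cons (f j) g, ?_, ?_⟩
    · intro i
      refine Fin.cases ?_ (fun i => ?_) i
      · simpa using hf j
      · simpa using hg i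
    · intro x
      rw [Fin.sum_univ_succ]
      simp only [Fin.cons_zero, Fin.cons_succ]
      have h := hgcov x
      by_cases hxv : x = v
      · subst hxv
        rw [if_pos hj]
        have e : w'' x = w x - 1 := by simp [hw'', hw']
        omega
      · have e' : w' x = w x := by simp [hw', hxv]
        by_cases hxj : x ∈ f j
        · have e : w'' x = w' x - 1 := by simp [hw'', hxv, hxj]
          rw [if_pos hxj]; omega
        · have e : w'' x = w' x := by simp [hw'', hxj]
          rw [if_neg hxj]; omega

theorem aux_exists_maxIndep [Fintype V] (G : SimpleGraph V) (I : Finset V) (hI : GIndep G I) :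
    ∃ J, GMaxIndep G J ∧ I ⊆ J := by
  obtain ⟨J, hIJ, hJ⟩ := (Set.toFinite {J : Finset V | GIndep G J}).exists_le_maximal hI
  exact ⟨J, ⟨hJ.1, fun K hK h => (hJ.2 hK h).antisymm h⟩, hIJ⟩

theorem aux_exists_maxClique [Fintype V] (G : SimpleGraph V) (I : Finset V)
    (hI : G.IsClique (I : Set V)) : ∃ J, GMaxClique G J ∧ I ⊆ J := by
  obtain ⟨J, hIJ, hJ⟩ :=
    (Set.toFinite {J : Finset V | G.IsClique (J : Set V)}).exists_le_maximal hI
  exact ⟨J, ⟨hJ.1, fun K hK h => (hJ.2 hK h).antisymm h⟩, hIJ⟩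

theorem aux_sum_indep [Fintype V] (G : SimpleGraph V) (P : V → ℝ) (h0 : ∀ v, 0 ≤ P v)
    (h : ∀ I : Finset V, GMaxIndep G I → ∑ v ∈ I, P v ≤ 1) (I : Finset V) (hI : GIndep G I) :
    ∑ v ∈ I, P v ≤ 1 := by
  obtain ⟨J, hJ, hIJ⟩ := aux_exists_maxIndep G I hI
  exact (Finset.sum_le_sum_of_subset_of_nonneg hIJ fun v _ _ => h0 v).trans (h J hJ)

/-- Indicators of cliques satisfy the independent set inequalities. -/
theorem aux_ind_le [Fintype V] (G : SimpleGraph V) {C I : Finset V}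
    (hC : G.IsClique (C : Set V)) (hI : GIndep G I) :
    ∑ v ∈ I, (if v ∈ C then (1 : ℝ) else 0) ≤ 1 := by
  have h := aux_inter_le_one G hC hI
  rw [Finset.sum_boole]
  have e : I.filter (fun v => v ∈ C) = C.filter (fun v => v ∈ I) := by
    ext; simp [and_comm]
  rw [e]; exact_mod_cast h

/-- A linear bound on generators passes to the convex hull. -/
theorem aux_hull_le [Fintype V] (s : Set (V → ℝ)) (a : V → ℝ) (u : ℝ)
    (h : ∀ x ∈ s, ∑ v, a v * x v ≤ u) : ∀ x ∈ convexHull ℝ s, ∑ v, a v * x v ≤ u := by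
  have hconv : Convex ℝ {x : V → ℝ | ∑ v, a v * x v ≤ u} := by
    refine convex_halfSpace_le (f := fun x : V → ℝ => ∑ v, a v * x v) ⟨?_, ?_⟩ u
    · intro x y; simp [mul_add, Finset.sum_add_distrib]
    · intro c x; simp only [Pi.smul_apply, smul_eq_mul, Finset.mul_sum]
      exact Finset.sum_congr rfl fun v _ => by ring
  exact fun x hx => convexHull_min h hconv hx

theorem aux_weighted_real [Fintype V] (G : SimpleGraph V) (hG : GPerfect G) (P : V → ℝ)
    (h0 : ∀ v, 0 ≤ P v) (hP : ∀ I : Finset V, GIndep G I → ∑ v ∈ I, P v ≤ 1)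
    (w : V → ℝ) (hw : ∀ v, 0 ≤ w v) (u : ℝ)
    (hu : ∀ C : Finset V, G.IsClique (C : Set V) → ∑ v ∈ C, w v ≤ u) :
    ∑ v, w v * P v ≤ u := by
  have hu0 : 0 ≤ u := by simpa using hu ∅ (by simp)
  have key : ∀ n : ℕ, (n : ℝ) * (∑ v, w v * P v - u) ≤ ∑ v, P v := by
    intro n
    set wn : V → ℕ := fun v => ⌊(n : ℝ) * w v⌋₊ with hwn
    have hnn : ∀ v, 0 ≤ (n : ℝ) * w v := fun v => mul_nonneg (Nat.cast_nonneg n) (hw v)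
    obtain ⟨f, hf, hcov⟩ := aux_weighted_s10 G hG _ wn ⌊(n : ℝ) * u⌋₊ rfl (by
      intro C hC
      refine Nat.le_floor ?_
      push_cast
      calc ∑ v ∈ C, (wn v : ℝ) ≤ ∑ v ∈ C, (n : ℝ) * w v :=
            Finset.sum_le_sum fun v _ => Nat.floor_le (hnn v)
        _ = n * ∑ v ∈ C, w v := by rw [Finset.mul_sum]
        _ ≤ n * u := mul_le_mul_of_nonneg_left (hu C hC) (Nat.cast_nonneg n))
    have h1 : ∑ v, (wn v : ℝ) * P v ≤ n * u := by
      calc ∑ v, (wn v : ℝ) * P v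
          ≤ ∑ v, ∑ j, (if v ∈ f j then P v else 0) := by
            refine Finset.sum_le_sum fun v _ => ?_
            have h : (wn v : ℝ) ≤ ∑ j, if v ∈ f j then (1 : ℝ) else 0 := by
              exact_mod_cast hcov v
            refine (mul_le_mul_of_nonneg_right h (h0 v)).trans (le_of_eq ?_)
            rw [Finset.sum_mul]
            exact Finset.sum_congr rfl fun j _ => by simp
        _ = ∑ j, ∑ v, (if v ∈ f j then P v else 0) := Finset.sum_comm
        _ ≤ ∑ j : Fin ⌊(n : ℝ) * u⌋₊, (1 : ℝ) := by
            refine Finset.sum_le_sum fun j _ => ?_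
            have := hP (f j) (hf j)
            simpa using this
        _ = (⌊(n : ℝ) * u⌋₊ : ℝ) := by simp
        _ ≤ n * u := Nat.floor_le (mul_nonneg (Nat.cast_nonneg n) hu0)
    have h2 : n * ∑ v, w v * P v ≤ ∑ v, (wn v : ℝ) * P v + ∑ v, P v := by
      rw [Finset.mul_sum, ← Finset.sum_add_distrib]
      refine Finset.sum_le_sum fun v _ => ?_
      have := Nat.lt_floor_add_one ((n : ℝ) * w v)
      have h3 : (n : ℝ) * w v * P v ≤ ((wn v : ℝ) + 1) * P v :=
        mul_le_mul_of_nonneg_right this.le (h0 v)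
      linarith
    rw [mul_sub]; linarith
  by_contra hcon
  push Not at hcon
  obtain ⟨n, hn⟩ := exists_nat_gt ((∑ v, P v) / (∑ v, w v * P v - u))
  rw [div_lt_iff₀ (by linarith)] at hn
  linarith [key n]

theorem aux_backward [Fintype V] (G : SimpleGraph V) (Cstar : Finset (Finset V))
    (hmax : ∀ C : Finset V, GMaxClique G C → C ∈ Cstar) (hG : GPerfect G) (P : V → ℝ)
    (h0 : ∀ v, 0 ≤ P v) (hP : ∀ I : Finset V, GIndep G I → ∑ v ∈ I, P v ≤ 1) :
    P ∈ convexHull ℝ {x : V → ℝ | ∃ S : Finset V, (∃ C ∈ Cstar, S ⊆ C) ∧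
          x = fun v => if v ∈ S then (1 : ℝ) else 0} := by
  by_contra hcon
  set s := {x : V → ℝ | ∃ S : Finset V, (∃ C ∈ Cstar, S ⊆ C) ∧
          x = fun v => if v ∈ S then (1 : ℝ) else 0} with hs
  have hfin : s.Finite := by
    refine (Set.finite_range
      (fun (S : Finset V) (v : V) => if v ∈ S then (1 : ℝ) else 0)).subset ?_
    rintro x ⟨S, -, rfl⟩
    exact ⟨S, rfl⟩
  obtain ⟨φ, u, hφ1, hφ2⟩ := geometric_hahn_banach_closed_point (convex_convexHull ℝ s)
    (hfin.isCompact_convexHull (𝕜 := ℝ)).isClosed hcon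
  set a : V → ℝ := fun v => φ (Pi.single v 1) with ha
  have hφ : ∀ x : V → ℝ, φ x = ∑ v, a v * x v := by
    intro x
    conv_lhs => rw [pi_eq_sum_univ' x]
    rw [map_sum]
    refine Finset.sum_congr rfl fun v _ => ?_
    rw [map_smul, smul_eq_mul, mul_comm]
  have hle := aux_weighted_real G hG P h0 hP (fun v => max (a v) 0) (fun v => le_max_right _ _) u (by
    intro C hC
    obtain ⟨D, hD, hCD⟩ := aux_exists_maxClique G C hC
    have hmem : (fun v => if v ∈ C.filter (fun v => 0 < a v) then (1 : ℝ) else 0) ∈ s :=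
      ⟨_, ⟨D, hmax D hD, (Finset.filter_subset _ _).trans hCD⟩, rfl⟩
    have h := hφ1 _ (subset_convexHull ℝ s hmem)
    rw [hφ] at h
    refine le_trans (le_of_eq ?_) h.le
    simp only [mul_ite, mul_one, mul_zero]
    rw [Finset.sum_ite_mem, Finset.univ_inter, Finset.sum_filter]
    refine Finset.sum_congr rfl fun v _ => ?_
    split_ifs with hv
    · exact max_eq_left hv.le
    · exact max_eq_right (not_lt.mp hv))
  rw [hφ] at hφ2
  have : ∑ v, a v * P v ≤ ∑ v, max (a v) 0 * P v :=
    Finset.sum_le_sum fun v _ => mul_le_mul_of_nonneg_right (le_max_left _ _) (h0 v)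
  linarith

/-- If every nonempty `W` has an independent set meeting all maximum cliques of `W`,
then the chromatic number is at most the clique number. -/
theorem aux_chrom_le [Fintype V] (G : SimpleGraph V)
    (h : ∀ W : Finset V, W.Nonempty → ∃ I, GIndep G I ∧ ∀ C ⊆ W, G.IsClique (C : Set V) →
      C.card = GCliqueNum G W → ∃ v ∈ C, v ∈ I) :
    ∀ (n : ℕ) (W : Finset V), GCliqueNum G W ≤ n → ∃ c : V → ℕ, (∀ v ∈ W, c v < n) ∧
      ∀ u ∈ W, ∀ v ∈ W, G.Adj u v → c u ≠ c v := by
  intro n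
  induction n with
  | zero =>
    intro W hW
    have hemp : ∀ v, v ∉ W := by
      intro v hv
      have := aux_le_cliqueNum G (W := W) (C := {v}) (by simpa using hv) (by simp)
      simp at this; omega
    exact ⟨fun _ => 0, fun v hv => (hemp v hv).elim, fun v hv => (hemp v hv).elim⟩
  | succ n ih =>
    intro W hW
    rcases W.eq_empty_or_nonempty with rfl | hne
    · exact ⟨fun _ => 0, by simp, by simp⟩
    obtain ⟨I, hI, hmeet⟩ := h W hne
    obtain ⟨c, hc1, hc2⟩ := ih (W \ I) (by
      obtain ⟨C, hCW, hC, hcard⟩ := aux_cliqueNum_mem G (W \ I)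
      have hCW' : C ⊆ W := hCW.trans Finset.sdiff_subset
      have h1 := aux_le_cliqueNum G hCW' hC
      have h2 : C.card ≠ GCliqueNum G W := by
        intro he
        obtain ⟨v, hv, hvI⟩ := hmeet C hCW' hC he
        exact (Finset.mem_sdiff.mp (hCW hv)).2 hvI
      omega)
    refine ⟨fun v => if v ∈ I then n else c v, ?_, ?_⟩
    · intro v hv
      by_cases hvI : v ∈ I
      · simp [hvI]
      · have := hc1 v (by simp [hv, hvI])
        simp only [hvI, if_false]; omega
    · intro x hx y hy hxy
      by_cases hxI : x ∈ I <;> by_cases hyI : y ∈ I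
      · exact (hI x hxI y hyI hxy).elim
      · have := hc1 y (by simp [hy, hyI])
        simp only [hxI, hyI, if_true, if_false]; omega
      · have := hc1 x (by simp [hx, hxI])
        simp only [hxI, hyI, if_true, if_false]; omega
      · simp only [hxI, hyI, if_false]
        exact hc2 x (by simp [hx, hxI]) y (by simp [hy, hyI]) hxy

theorem aux_perfect [Fintype V] (G : SimpleGraph V)
    (h : ∀ W : Finset V, W.Nonempty → ∃ I, GIndep G I ∧ ∀ C ⊆ W, G.IsClique (C : Set V) →
      C.card = GCliqueNum G W → ∃ v ∈ C, v ∈ I) : GPerfect G := by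
  intro W
  apply le_antisymm
  · exact Nat.sInf_le (aux_chrom_le G h _ W le_rfl)
  · obtain ⟨c, hc1, hc2⟩ := aux_chrom_mem G W
    obtain ⟨C, hCW, hC, hcard⟩ := aux_cliqueNum_mem G W
    rw [← hcard, ← Finset.card_range (GChrom G W)]
    refine Finset.card_le_card_of_injOn c (fun v hv => by simpa using hc1 v (hCW hv)) ?_
    intro x hx y hy hxy
    by_contra hne
    exact hc2 x (hCW hx) y (hCW hy) (hC hx hy hne) hxy

theorem aux_meet [Fintype V] (G : SimpleGraph V)
    (hsub : ∀ P : V → ℝ, (∀ v, 0 ≤ P v) → (∀ I : Finset V, GIndep G I → ∑ v ∈ I, P v ≤ 1) →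
      ∀ W : Finset V, ∑ v ∈ W, P v ≤ GCliqueNum G W)
    (W : Finset V) (hW : W.Nonempty) : ∃ I, GIndep G I ∧ ∀ C ⊆ W, G.IsClique (C : Set V) →
      C.card = GCliqueNum G W → ∃ v ∈ C, v ∈ I := by
  by_contra hcon
  push Not at hcon
  set M : Finset (Finset V) := Finset.univ.filter (fun C => C ⊆ W ∧ G.IsClique (C : Set V) ∧
    C.card = GCliqueNum G W) with hM
  have hMne : M.Nonempty := by
    obtain ⟨C, h1, h2, h3⟩ := aux_cliqueNum_mem G W
    exact ⟨C, by simp [hM, h1, h2, h3]⟩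
  have hm1 : (1 : ℝ) ≤ M.card := by exact_mod_cast hMne.card_pos
  have hω : 1 ≤ GCliqueNum G W := by
    obtain ⟨v, hv⟩ := hW
    simpa using aux_le_cliqueNum G (W := W) (C := {v}) (by simpa using hv) (by simp)
  have hω' : (1 : ℝ) ≤ GCliqueNum G W := by exact_mod_cast hω
  -- the sum of indicators of maximum cliques
  set x : V → ℝ := fun v => ∑ C ∈ M, if v ∈ C then (1 : ℝ) else 0 with hx
  have hx0 : ∀ v, 0 ≤ x v := fun v => Finset.sum_nonneg fun C _ => by split_ifs <;> norm_num
  have hxI : ∀ I : Finset V, GIndep G I → ∑ v ∈ I, x v ≤ M.card - 1 := by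
    intro I hI
    obtain ⟨C, hCW, hC, hcard, hdis⟩ := hcon I hI
    have hCM : C ∈ M := by simp [hM, hCW, hC, hcard]
    simp only [hx]
    rw [Finset.sum_comm, ← Finset.add_sum_erase _ _ hCM]
    have hz : ∑ v ∈ I, (if v ∈ C then (1 : ℝ) else 0) = 0 :=
      Finset.sum_eq_zero fun v hv => if_neg fun hvC => hdis v hvC hv
    rw [hz, zero_add]
    calc ∑ D ∈ M.erase C, ∑ v ∈ I, (if v ∈ D then (1 : ℝ) else 0)
        ≤ ∑ D ∈ M.erase C, (1 : ℝ) := by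
          refine Finset.sum_le_sum fun D hD => ?_
          have hDM := Finset.mem_of_mem_erase hD
          simp only [hM, Finset.mem_filter] at hDM
          exact aux_ind_le G hDM.2.2.1 hI
      _ = M.card - 1 := by
          rw [Finset.sum_const, Finset.card_erase_of_mem hCM, nsmul_eq_mul, mul_one,
            Nat.cast_sub hMne.card_pos]
          simp
  have hxW : ∑ v ∈ W, x v = M.card * GCliqueNum G W := by
    simp only [hx]
    rw [Finset.sum_comm, ← nsmul_eq_mul, ← Finset.sum_const]
    refine Finset.sum_congr rfl fun D hD => ?_
    simp only [hM, Finset.mem_filter] at hD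
    rw [Finset.sum_ite_mem, Finset.inter_eq_right.mpr hD.2.1, ← hD.2.2.2]
    simp
  -- `x / (m - 1/2)` still satisfies all the inequalities
  have hpos : (0 : ℝ) < M.card - 1 / 2 := by linarith
  have := hsub (fun v => x v / (M.card - 1 / 2)) (fun v => div_nonneg (hx0 v) hpos.le) (by
    intro I hI
    rw [← Finset.sum_div, div_le_one hpos]
    linarith [hxI I hI]) W
  rw [← Finset.sum_div, hxW, div_le_iff₀ hpos] at this
  nlinarith

/-- (Lemma: Polytope Duality, part 2.)  With `𝒞*` a nonempty
family of cliques of `G` and `𝒮*` the family of all subsets of members of `𝒞*`,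
the equality
`convexHull {1_S : S ∈ 𝒮*} = {P ≥ 0 : ∑_{v ∈ I} P v ≤ 1 for all maximal independent I}`
holds if and only if `𝒞*` contains every maximal clique of `G` and `G` is perfect. -/
theorem stmt_10
    [Fintype V] (G : SimpleGraph V)
    (Cstar : Finset (Finset V)) (hCne : Cstar.Nonempty)
    (hCclique : ∀ C ∈ Cstar, G.IsClique (C : Set V)) :
    (convexHull ℝ
        {x : V → ℝ | ∃ S : Finset V, (∃ C ∈ Cstar, S ⊆ C) ∧
          x = fun v => if v ∈ S then (1 : ℝ) else 0}
      = {P : V → ℝ | (∀ v, 0 ≤ P v) ∧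
          ∀ I : Finset V, GMaxIndep G I → ∑ v ∈ I, P v ≤ 1})
    ↔ ((∀ C : Finset V, GMaxClique G C → C ∈ Cstar) ∧ GPerfect G) := by
  constructor
  · intro heq
    constructor
    · intro C hC
      have hmem : (fun v => if v ∈ C then (1 : ℝ) else 0) ∈ {P : V → ℝ | (∀ v, 0 ≤ P v) ∧
          ∀ I : Finset V, GMaxIndep G I → ∑ v ∈ I, P v ≤ 1} :=
        ⟨fun v => by dsimp only; split_ifs <;> norm_num, fun I hI => aux_ind_le G hC.1 hI.1⟩
      rw [← heq] at hmem
      by_contra hCn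
      have h := aux_hull_le _ (fun v => if v ∈ C then (1 : ℝ) else -1) (C.card - 1) (by
        rintro x ⟨S, ⟨D, hD, hSD⟩, rfl⟩
        have hnot : ¬ C ⊆ S := fun hCS =>
          hCn (hC.2 D (hCclique D hD) (hCS.trans hSD) ▸ hD)
        obtain ⟨z, hzC, hzS⟩ := Finset.not_subset.mp hnot
        have h1 : ∑ v, (if v ∈ C then (1 : ℝ) else -1) * (if v ∈ S then (1 : ℝ) else 0)
            ≤ ∑ v, if v ∈ C.erase z then (1 : ℝ) else 0 := by
          refine Finset.sum_le_sum fun v _ => ?_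
          by_cases hvz : v = z
          · subst hvz; simp [hzS]
          · by_cases hvC : v ∈ C <;> by_cases hvS : v ∈ S <;> simp [hvC, hvS, hvz]
        refine h1.trans (le_of_eq ?_)
        rw [Finset.sum_ite_mem, Finset.univ_inter, Finset.sum_const,
          Finset.card_erase_of_mem hzC, nsmul_eq_mul, mul_one,
          Nat.cast_sub (Finset.card_pos.mpr ⟨z, hzC⟩)]
        simp) _ hmem
      have e : ∑ v, (if v ∈ C then (1 : ℝ) else -1) * (if v ∈ C then (1 : ℝ) else 0)
          = C.card := by
        rw [Finset.sum_congr rfl (g := fun v => if v ∈ C then (1 : ℝ) else 0)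
          (fun v _ => by split_ifs <;> simp)]
        simp
      linarith
    · refine aux_perfect G (aux_meet G ?_)
      intro P h0 hP W
      have hmem : P ∈ {P : V → ℝ | (∀ v, 0 ≤ P v) ∧
          ∀ I : Finset V, GMaxIndep G I → ∑ v ∈ I, P v ≤ 1} := ⟨h0, fun I hI => hP I hI.1⟩
      rw [← heq] at hmem
      have h := aux_hull_le _ (fun v => if v ∈ W then (1 : ℝ) else 0) (GCliqueNum G W) (by
        rintro x ⟨S, ⟨D, hD, hSD⟩, rfl⟩
        have hcl : G.IsClique ((W ∩ S : Finset V) : Set V) :=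
          (hCclique D hD).subset (by
            exact_mod_cast (Finset.inter_subset_right.trans hSD : W ∩ S ⊆ D))
        have h2 := aux_le_cliqueNum G (W := W) Finset.inter_subset_left hcl
        have e : ∑ v, (if v ∈ W then (1 : ℝ) else 0) * (if v ∈ S then (1 : ℝ) else 0)
            = (W ∩ S).card := by
          simp [Finset.inter_comm]
        rw [e]; exact_mod_cast h2) P hmem
      simpa using h
  · rintro ⟨hmax, hG⟩
    apply Set.Subset.antisymm
    · refine convexHull_min ?_ ?_
      · rintro x ⟨S, ⟨D, hD, hSD⟩, rfl⟩
        refine ⟨fun v => by dsimp only; split_ifs <;> norm_num, fun I hI => aux_ind_le G ?_ hI.1⟩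
        exact (hCclique D hD).subset (by exact_mod_cast hSD)
      · rintro x ⟨hx0, hx⟩ y ⟨hy0, hy⟩ a b ha hb hab
        refine ⟨fun v => ?_, fun I hI => ?_⟩
        · have h1 := mul_nonneg ha (hx0 v)
          have h2 := mul_nonneg hb (hy0 v)
          simpa using add_nonneg h1 h2
        · have h1 := mul_le_mul_of_nonneg_left (hx I hI) ha
          have h2 := mul_le_mul_of_nonneg_left (hy I hI) hb
          simp only [Pi.add_apply, Pi.smul_apply, smul_eq_mul, Finset.sum_add_distrib,
            ← Finset.mul_sum]
          linarith
    · rintro P ⟨h0, hP⟩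
      exact aux_backward G Cstar hmax hG P h0 (aux_sum_indep G P h0 hP)
end

section
/- Assume in addition that 𝒞* includes all maximal cliques of G and that G is perfect. Then the convex hull in ℝ^{V_G} of the indicator vectors {1_C : C ∈ 𝒞*} equals {P ∈ Δ^K : ∑_{v∈I} P(v) ≤ 1 for every maximal independent set I of G}. -/
open scoped Classical

variable {V : Type*}

/-- Weighted covering number of a vertex by a multiset of sets. -/
noncomputable def covSum (s : Multiset (Finset V)) (v : V) : ℕ :=
  (s.map (fun I => if v ∈ I then 1 else 0)).sum

lemma covSum_cons (I : Finset V) (s : Multiset (Finset V)) (v : V) :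
    covSum (I ::ₘ s) v = (if v ∈ I then 1 else 0) + covSum s v := by
  simp [covSum]

lemma clique_indep_card (G : SimpleGraph V) (Q I : Finset V)
    (hQ : G.IsClique (Q : Set V)) (hI : GIndep G I) :
    ∑ v ∈ Q, (if v ∈ I then 1 else 0) ≤ 1 := by
  rw [← Finset.sum_filter, Finset.sum_const, smul_eq_mul, mul_one, Finset.card_le_one]
  intro a ha b hb
  simp only [Finset.mem_filter] at ha hb
  by_contra hab
  exact hI a ha.2 b hb.2 (hQ ha.1 hb.1 hab)

lemma covSum_clique_le (G : SimpleGraph V) (Q : Finset V) (hQ : G.IsClique (Q : Set V))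
    (s : Multiset (Finset V)) (hs : ∀ I ∈ s, GIndep G I) :
    ∑ v ∈ Q, covSum s v ≤ s.card := by
  induction s using Multiset.induction_on with
  | empty => simp [covSum]
  | cons I s ih =>
    simp only [covSum_cons, Finset.sum_add_distrib, Multiset.card_cons]
    have h1 := clique_indep_card G Q I hQ (hs I (by simp))
    have h2 := ih (fun J hJ => hs J (by simp [hJ]))
    omega

lemma cov_base [Fintype V] (G : SimpleGraph V) (hp : GPerfect G) (w : V → ℕ) (m : ℕ)
    (hw : ∀ v, w v ≤ 1)
    (hm : ∀ Q : Finset V, G.IsClique (Q : Set V) → ∑ v ∈ Q, w v ≤ m) :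
    ∃ s : Multiset (Finset V), s.card = m ∧ (∀ I ∈ s, GIndep G I) ∧
      ∀ v, covSum s v = w v := by
  set W : Finset V := Finset.univ.filter (fun v => w v = 1) with hW
  have hle : GCliqueNum G W ≤ m := by
    unfold GCliqueNum
    refine csSup_le ⟨0, ∅, by simp⟩ ?_
    rintro n ⟨C, hCW, hC, rfl⟩
    refine le_trans (le_of_eq ?_) (hm C hC)
    rw [Finset.card_eq_sum_ones]
    apply Finset.sum_congr rfl
    intro v hv
    have := hCW hv
    simp [hW] at this
    exact this.symm
  rw [← hp W] at hle
  have hmem : GChrom G W ∈ {n : ℕ | ∃ c : V → ℕ, (∀ v ∈ W, c v < n) ∧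
      ∀ u ∈ W, ∀ v ∈ W, G.Adj u v → c u ≠ c v} := by
    apply Nat.sInf_mem
    let e := Fintype.equivFin V
    refine ⟨Fintype.card V, fun v => (e v : ℕ), fun v _ => (e v).2, ?_⟩
    intro u _ v _ huv h
    exact huv.ne (e.injective (Fin.ext h))
  obtain ⟨c, hc1, hc2⟩ := hmem
  refine ⟨(Multiset.range m).map (fun i => W.filter (fun v => c v = i)), by simp, ?_, ?_⟩
  · intro I hI
    obtain ⟨i, _, rfl⟩ := Multiset.mem_map.1 hI
    intro a ha b hb hab
    simp only [Finset.mem_filter] at ha hb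
    exact hc2 a ha.1 b hb.1 hab (ha.2.trans hb.2.symm)
  · intro v
    have h0 : covSum ((Multiset.range m).map (fun i => W.filter (fun v => c v = i))) v
        = ∑ i ∈ Finset.range m, if v ∈ W.filter (fun v => c v = i) then 1 else 0 := by
      simp only [covSum, Multiset.map_map]
      rfl
    rw [h0]
    by_cases hv : v ∈ W
    · have h1 : w v = 1 := by simpa [hW] using hv
      have h2 : c v < m := (hc1 v hv).trans_le hle
      simp [hv, h1, h2]
    · have h1 : w v = 0 := by
        have : w v ≠ 1 := by simpa [hW] using hv
        have := hw v
        omega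
      simp [hv, h1]

lemma cov_exists [Fintype V] (G : SimpleGraph V) (hp : GPerfect G) :
    ∀ (n : ℕ) (w : V → ℕ) (m : ℕ), ∑ v, w v = n →
    (∀ Q : Finset V, G.IsClique (Q : Set V) → ∑ v ∈ Q, w v ≤ m) →
    ∃ s : Multiset (Finset V), s.card = m ∧ (∀ I ∈ s, GIndep G I) ∧
      ∀ v, covSum s v = w v := by
  intro n
  induction n using Nat.strong_induction_on with
  | _ n ih =>
  intro w m hn hm
  by_cases hw : ∀ v, w v ≤ 1
  · exact cov_base G hp w m hw hm
  push Not at hw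
  obtain ⟨x, hx⟩ := hw
  -- decrease the weight of `x`
  have hlt : ∑ v, (w v - if v = x then 1 else 0) < n := by
    rw [← hn]
    apply Finset.sum_lt_sum
    · intro v _; omega
    · exact ⟨x, Finset.mem_univ _, by simp; omega⟩
  obtain ⟨s, hs1, hs2, hs3⟩ := ih _ hlt (fun v => w v - if v = x then 1 else 0) m rfl
    (fun Q hQ => (Finset.sum_le_sum (fun v _ => Nat.sub_le _ _)).trans (hm Q hQ))
  have hxI : ∃ I ∈ s, x ∈ I := by
    by_contra hcon
    push Not at hcon
    have h0 : covSum s x = 0 := by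
      unfold covSum
      rw [Multiset.sum_eq_zero]
      intro y hy
      obtain ⟨I, hI, rfl⟩ := Multiset.mem_map.1 hy
      simp [hcon I hI]
    have := hs3 x
    simp at this
    omega
  obtain ⟨I, hIs, hxI⟩ := hxI
  obtain ⟨s', rfl⟩ := Multiset.exists_cons_of_mem hIs
  have hIind : GIndep G I := hs2 I (by simp)
  have hpos : ∀ v, (if v ∈ I then 1 else 0) ≤ w v := by
    intro v
    have h := hs3 v
    rw [covSum_cons] at h
    omega
  simp only [Multiset.card_cons] at hs1
  have hlt2 : ∑ v, (w v - if v ∈ I then 1 else 0) < n := by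
    rw [← hn]
    apply Finset.sum_lt_sum
    · intro v _; omega
    · exact ⟨x, Finset.mem_univ _, by simp [hxI]; omega⟩
  obtain ⟨t, ht1, ht2, ht3⟩ := ih _ hlt2 (fun v => w v - if v ∈ I then 1 else 0) (m - 1) rfl (by
    intro Q hQ
    by_cases hxQ : x ∈ Q
    · have h1 : ∑ v ∈ Q, (w v - if v ∈ I then 1 else 0) < ∑ v ∈ Q, w v := by
        apply Finset.sum_lt_sum
        · intro v _; omega
        · exact ⟨x, hxQ, by simp [hxI]; omega⟩
      have := hm Q hQ
      show ∑ v ∈ Q, (w v - if v ∈ I then 1 else 0) ≤ m - 1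
      omega
    · have h1 : ∑ v ∈ Q, (w v - if v ∈ I then 1 else 0) = ∑ v ∈ Q, covSum s' v := by
        apply Finset.sum_congr rfl
        intro v hv
        have hvx : v ≠ x := fun h => hxQ (h ▸ hv)
        have h := hs3 v
        rw [covSum_cons] at h
        simp only [hvx, if_false] at h
        omega
      have h2 := covSum_clique_le G Q hQ s' (fun J hJ => hs2 J (by simp [hJ]))
      show ∑ v ∈ Q, (w v - if v ∈ I then 1 else 0) ≤ m - 1
      omega)
  refine ⟨I ::ₘ t, by simp; omega, ?_, ?_⟩
  · intro J hJ
    rcases Multiset.mem_cons.1 hJ with rfl | hJ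
    · exact hIind
    · exact ht2 J hJ
  · intro v
    rw [covSum_cons, ht3 v]
    have := hpos v
    omega

lemma covSum_weight [Fintype V] (P : V → ℝ) (s : Multiset (Finset V))
    (hs : ∀ I ∈ s, ∑ v ∈ I, P v ≤ 1) :
    ∑ v, (covSum s v : ℝ) * P v ≤ s.card := by
  induction s using Multiset.induction_on with
  | empty => simp [covSum]
  | cons I s ih =>
    have h1 := hs I (by simp)
    have h2 := ih (fun J hJ => hs J (by simp [hJ]))
    simp only [covSum_cons, Multiset.card_cons]
    push_cast
    simp only [add_mul, Finset.sum_add_distrib, ite_mul, one_mul, zero_mul]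
    rw [← Finset.sum_filter]
    simp only [Finset.filter_mem_eq_inter, Finset.univ_inter]
    linarith

lemma extend_max [Fintype V] (p : Finset V → Prop) (A : Finset V) (hA : p A) :
    ∃ B, A ⊆ B ∧ p B ∧ ∀ C, p C → B ⊆ C → C = B := by
  obtain ⟨B, hAB, hB⟩ := (Set.toFinite {B | p B}).exists_le_maximal hA
  exact ⟨B, hAB, hB.prop, fun C hC hBC => (hB.eq_of_le hC hBC).symm⟩

lemma sum_parts [Fintype V] (K : ℕ) (part : Fin K → Finset V)
    (hdisj : ∀ k l, k ≠ l → Disjoint (part k) (part l))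
    (hcover : ∀ v : V, ∃ k, v ∈ part k) (g : V → ℝ) :
    ∑ v, g v = ∑ k, ∑ v ∈ part k, g v := by
  rw [← Finset.sum_biUnion (fun k _ l _ h => hdisj k l h)]
  apply Finset.sum_congr _ (fun _ _ => rfl)
  ext v
  simpa using hcover v

/-- (Lemma: Polytope Duality for K-partite graphs, part 2.)
Let `G` be a finite simple graph that is `K`-partite with parts `V_1, …, V_K`, and
let `𝒞*` be a nonempty family of cliques of `G`, each containing exactly one vertex
from each part.  If, in addition, `𝒞*` includes all maximal cliques of `G` and `G`
is perfect, then the convex hull of `{1_C : C ∈ 𝒞*}` equals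
`{P ∈ Δ^K : ∑_{v ∈ I} P v ≤ 1 for every maximal independent set I of G}`. -/
theorem stmt_12
    [Fintype V] (G : SimpleGraph V)
    (K : ℕ) (part : Fin K → Finset V)
    (hne : ∀ k, (part k).Nonempty)
    (hdisj : ∀ k l, k ≠ l → Disjoint (part k) (part l))
    (hcover : ∀ v : V, ∃ k, v ∈ part k)
    (hindep : ∀ k, ∀ a ∈ part k, ∀ b ∈ part k, ¬ G.Adj a b)
    (Cstar : Finset (Finset V)) (hCne : Cstar.Nonempty)
    (hCclique : ∀ C ∈ Cstar, G.IsClique (C : Set V))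
    (hCpart : ∀ C ∈ Cstar, ∀ k, (C ∩ part k).card = 1)
    (hmaxclique : ∀ C : Finset V, GMaxClique G C → C ∈ Cstar)
    (hperfect : GPerfect G) :
    convexHull ℝ
        {x : V → ℝ | ∃ C ∈ Cstar, x = fun v => if v ∈ C then (1 : ℝ) else 0}
      = {P : V → ℝ | ((∀ v, 0 ≤ P v) ∧ ∀ k, ∑ v ∈ part k, P v = 1) ∧
          ∀ I : Finset V, GMaxIndep G I → ∑ v ∈ I, P v ≤ 1} := by
  have hCsum : ∀ C ∈ Cstar, ∀ k, ∑ v ∈ part k, (if v ∈ C then (1 : ℝ) else 0) = 1 := by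
    intro C hC k
    rw [← Finset.sum_filter, Finset.sum_const, Finset.filter_mem_eq_inter, Finset.inter_comm,
      hCpart C hC k]
    simp
  apply Set.Subset.antisymm
  · apply convexHull_min
    · rintro _ ⟨C, hC, rfl⟩
      refine ⟨⟨fun v => by dsimp only; split_ifs <;> norm_num, hCsum C hC⟩, ?_⟩
      intro I hI
      have h := clique_indep_card G C I (hCclique C hC) hI.1
      rw [← Finset.sum_filter, Finset.filter_mem_eq_inter, Finset.inter_comm,
        ← Finset.filter_mem_eq_inter, Finset.sum_filter] at h
      show ∑ v ∈ I, (if v ∈ C then (1 : ℝ) else 0) ≤ 1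
      exact_mod_cast h
    · rintro x ⟨⟨hx1, hx2⟩, hx3⟩ y ⟨⟨hy1, hy2⟩, hy3⟩ a b ha hb hab
      refine ⟨⟨fun v => ?_, fun k => ?_⟩, fun I hI => ?_⟩
      · simp only [Pi.add_apply, Pi.smul_apply, smul_eq_mul]
        exact add_nonneg (mul_nonneg ha (hx1 v)) (mul_nonneg hb (hy1 v))
      · simp only [Pi.add_apply, Pi.smul_apply, smul_eq_mul, Finset.sum_add_distrib,
          ← Finset.mul_sum, hx2, hy2]
        linarith
      · simp only [Pi.add_apply, Pi.smul_apply, smul_eq_mul, Finset.sum_add_distrib,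
          ← Finset.mul_sum]
        nlinarith [mul_le_mul_of_nonneg_left (hx3 I hI) ha,
          mul_le_mul_of_nonneg_left (hy3 I hI) hb]
  · rintro P ⟨⟨hP0, hPk⟩, hPI⟩
    by_contra hnot
    have hfin : Set.Finite
        {x : V → ℝ | ∃ C ∈ Cstar, x = fun v => if v ∈ C then (1 : ℝ) else 0} := by
      refine (Cstar.finite_toSet.image
        (fun C : Finset V => fun v => if v ∈ C then (1 : ℝ) else 0)).subset ?_
      rintro _ ⟨C, hC, rfl⟩
      exact ⟨C, hC, rfl⟩
    obtain ⟨f, u, hfu, huP⟩ := geometric_hahn_banach_closed_point (convex_convexHull ℝ _)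
      (hfin.isClosed_convexHull ℝ) hnot
    obtain ⟨c, hc⟩ : ∃ c : V → ℝ, ∀ y : V → ℝ, f y = ∑ v, c v * y v := by
      refine ⟨fun v => f (Pi.single v 1), fun y => ?_⟩
      conv_lhs => rw [pi_eq_sum_univ' y]
      rw [map_sum]
      apply Finset.sum_congr rfl
      intro v _
      rw [map_smul, smul_eq_mul, mul_comm]
    -- shift to nonnegative weights
    set t : ℝ := ∑ v, |c v| with ht
    have hd0 : ∀ v, 0 ≤ c v + t := by
      intro v
      have h1 : |c v| ≤ t :=
        Finset.single_le_sum (f := fun v => |c v|) (fun i _ => abs_nonneg _) (Finset.mem_univ v)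
      have h2 := neg_abs_le (c v)
      linarith
    have hPK : ∑ v, P v = K := by
      rw [sum_parts K part hdisj hcover]; simp [hPk]
    have hdP : u + t * K < ∑ v, (c v + t) * P v := by
      rw [hc] at huP
      simp only [add_mul, Finset.sum_add_distrib, ← Finset.mul_sum, hPK]
      linarith
    have hdC : ∀ C ∈ Cstar, ∑ v ∈ C, (c v + t) ≤ u + t * K := by
      intro C hC
      have h1 := hfu _ (subset_convexHull ℝ _ ⟨C, hC, rfl⟩)
      rw [hc] at h1
      have h2 : ∑ v, (if v ∈ C then (1 : ℝ) else 0) = K := by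
        rw [sum_parts K part hdisj hcover]; simp only [hCsum C hC]; simp
      have h3 : ∑ v ∈ C, (c v + t) = ∑ v, (c v + t) * (if v ∈ C then (1 : ℝ) else 0) := by
        simp
      rw [h3]
      simp only [add_mul, Finset.sum_add_distrib, ← Finset.mul_sum, h2]
      linarith
    have hu0 : 0 ≤ u + t * K := by
      obtain ⟨C, hC⟩ := hCne
      exact (Finset.sum_nonneg (fun v _ => hd0 v)).trans (hdC C hC)
    have hdQ : ∀ Q : Finset V, G.IsClique (Q : Set V) → ∑ v ∈ Q, (c v + t) ≤ u + t * K := by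
      intro Q hQ
      obtain ⟨C, hQC, hC, hmax⟩ := extend_max (fun C : Finset V => G.IsClique (C : Set V)) Q hQ
      exact (Finset.sum_le_sum_of_subset_of_nonneg hQC (fun v _ _ => hd0 v)).trans
        (hdC C (hmaxclique C ⟨hC, hmax⟩))
    have hPind : ∀ I : Finset V, GIndep G I → ∑ v ∈ I, P v ≤ 1 := by
      intro I hI
      obtain ⟨J, hIJ, hJ, hmax⟩ := extend_max (fun J : Finset V => GIndep G J) I hI
      exact (Finset.sum_le_sum_of_subset_of_nonneg hIJ (fun v _ _ => hP0 v)).trans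
        (hPI J ⟨hJ, hmax⟩)
    have key : ∀ N : ℕ, (N : ℝ) * (∑ v, (c v + t) * P v - (u + t * K)) ≤ K := by
      intro N
      have hN : (0 : ℝ) ≤ N := Nat.cast_nonneg N
      obtain ⟨s, hs1, hs2, hs3⟩ := cov_exists G hperfect _ (fun v => ⌊(N : ℝ) * (c v + t)⌋₊)
        ⌊(N : ℝ) * (u + t * K)⌋₊ rfl (by
          intro Q hQ
          apply Nat.le_floor
          push_cast
          calc ∑ v ∈ Q, (⌊(N : ℝ) * (c v + t)⌋₊ : ℝ) ≤ ∑ v ∈ Q, (N : ℝ) * (c v + t) :=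
                Finset.sum_le_sum (fun v _ => Nat.floor_le (mul_nonneg hN (hd0 v)))
            _ = N * ∑ v ∈ Q, (c v + t) := by rw [Finset.mul_sum]
            _ ≤ _ := mul_le_mul_of_nonneg_left (hdQ Q hQ) hN)
      have h1 := covSum_weight P s (fun I hI => hPind I (hs2 I hI))
      rw [hs1] at h1
      have h2 := Nat.floor_le (mul_nonneg hN hu0)
      have h3 : ∑ v, ((N : ℝ) * (c v + t) - 1) * P v ≤ ∑ v, (covSum s v : ℝ) * P v := by
        apply Finset.sum_le_sum
        intro v _
        apply mul_le_mul_of_nonneg_right _ (hP0 v)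
        rw [hs3 v]
        exact (Nat.sub_one_lt_floor _).le
      have h4 : ∑ v, ((N : ℝ) * (c v + t) - 1) * P v
          = N * ∑ v, (c v + t) * P v - K := by
        rw [← hPK, Finset.mul_sum, ← Finset.sum_sub_distrib]
        apply Finset.sum_congr rfl
        intro v _
        ring
      rw [mul_sub]
      linarith
    have hpos : 0 < ∑ v, (c v + t) * P v - (u + t * K) := by linarith
    obtain ⟨N, hN⟩ := exists_nat_gt ((K : ℝ) / (∑ v, (c v + t) * P v - (u + t * K)))
    rw [div_lt_iff₀ hpos] at hN
    exact absurd (key N) (not_le.2 hN)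
end

section
/- The following are equivalent: (1) for every maximal clique C of the potential response graph G there exists r* ∈ ℛ* compatible with every vertex of C, i.e., the intersection ⋂_{v∈C} S_v is nonempty; (2) the pairwise incompatibility criterion holds: for every finite set of vertices v_1, …, v_m ∈ V_G with ⋂_{k=1}^{m} S_{v_k} = ∅, there exist indices i ≠ j with S_{v_i} ∩ S_{v_j} = ∅. -/
open scoped Classical

variable {R X Z : Type*}

/-- (Proposition: pairwise incompatibility.)  The following are
equivalent: (1) every maximal clique `C` of the potential response graph admits a
support point `r* ∈ ℛ*` compatible with every vertex of `C` (i.e. `⋂_{v ∈ C} S_v ≠ ∅`);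
(2) for every finite tuple of vertices `v_1, …, v_m` of `G` with
`⋂_k S_{v_k} = ∅`, there are indices `i ≠ j` with `S_{v_i} ∩ S_{v_j} = ∅`,
where `S_{(r,z)} = {r* ∈ ℛ* : T(r*,z) = r}`. -/
theorem stmt_15
    [Fintype R] [Fintype X] [Fintype Z]
    [Nonempty R] [Nonempty X] [Nonempty Z]
    (T : (X → R) → Z → R)
    (Rstar : Finset (X → R)) (hRstar : Rstar.Nonempty) :
    (∀ C : Finset (R × Z), PRMaxClique T Rstar C →
        ∃ rs ∈ Rstar, ∀ p ∈ C, T rs p.2 = p.1)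
    ↔ (∀ (m : ℕ) (w : Fin m → R × Z),
        (∀ k, PRVert T Rstar (w k)) →
        (¬ ∃ rs ∈ Rstar, ∀ k, T rs (w k).2 = (w k).1) →
        ∃ i j : Fin m, i ≠ j ∧
          ¬ ∃ rs ∈ Rstar, T rs (w i).2 = (w i).1 ∧ T rs (w j).2 = (w j).1) := by
  constructor
  · intro h m w hw hne
    by_contra hcon
    push Not at hcon
    have hC : PRClique T Rstar (Finset.univ.image w) := by
      constructor
      · intro p hp
        obtain ⟨k, -, rfl⟩ := Finset.mem_image.1 hp
        exact hw k
      · intro p hp q hq hpq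
        obtain ⟨k, -, rfl⟩ := Finset.mem_image.1 hp
        obtain ⟨l, -, rfl⟩ := Finset.mem_image.1 hq
        exact ⟨hpq, hcon k l (fun e => hpq (by rw [e]))⟩
    obtain ⟨D, hCD, hD⟩ := Finite.exists_le_maximal (p := PRClique T Rstar) hC
    obtain ⟨rs, hrs, hall⟩ := h D
      ⟨hD.prop, fun C' hC' hle => Finset.Subset.antisymm (hD.le_of_ge hC' hle) hle⟩
    exact hne ⟨rs, hrs, fun k =>
      hall _ (hCD (Finset.mem_image_of_mem w (Finset.mem_univ k)))⟩
  · intro h C hC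
    by_contra hcon
    obtain ⟨i, j, hij, hn⟩ := h C.card (fun k => (C.equivFin.symm k : R × Z))
      (fun k => hC.1.1 _ (C.equivFin.symm k).2)
      (by
        rintro ⟨rs, hrs, hall⟩
        refine hcon ⟨rs, hrs, fun p hp => ?_⟩
        have := hall (C.equivFin ⟨p, hp⟩)
        simpa using this)
    refine hn (hC.1.2 _ (C.equivFin.symm i).2 _ (C.equivFin.symm j).2 ?_).2
    intro e
    exact hij (C.equivFin.symm.injective (Subtype.ext e))
end

section
/- For every finite family of vertices v_1, …, v_m ∈ 𝒴 × 𝒟 × 𝒵 such that ⋂_{k=1}^{m} S_{v_k} = ∅, there exist indices i ≠ j with S_{v_i} ∩ S_{v_j} = ∅. -/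
/-- (Exclusion restriction satisfies the pairwise incompatibility
criterion.)  Let `𝒴, 𝒟, 𝒵` be nonempty sets and let `ℛ*` be the set of all pairs
`(Y, D)` with `Y : 𝒟 → 𝒴` and `D : 𝒵 → 𝒟`.  For a triple `v = (y, d, z)`, let
`S_v = {(Y, D) : Y(d) = y ∧ D(z) = d}`.  Then for every finite family of vertices
`v_1, …, v_m` with `⋂_k S_{v_k} = ∅`, there exist `i ≠ j` with
`S_{v_i} ∩ S_{v_j} = ∅`. -/
theorem stmt_16
    {Y D Z : Type*} [Nonempty Y] [Nonempty D] [Nonempty Z]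
    (m : ℕ) (v : Fin m → Y × D × Z)
    (hempty : ¬ ∃ p : (D → Y) × (Z → D),
        ∀ k : Fin m, p.1 (v k).2.1 = (v k).1 ∧ p.2 (v k).2.2 = (v k).2.1) :
    ∃ i j : Fin m, i ≠ j ∧
      ¬ ∃ p : (D → Y) × (Z → D),
        (p.1 (v i).2.1 = (v i).1 ∧ p.2 (v i).2.2 = (v i).2.1) ∧
        (p.1 (v j).2.1 = (v j).1 ∧ p.2 (v j).2.2 = (v j).2.1) := by
  classical
  by_contra hcon
  have hpair : ∀ i j : Fin m,
      ((v i).2.1 = (v j).2.1 → (v i).1 = (v j).1) ∧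
      ((v i).2.2 = (v j).2.2 → (v i).2.1 = (v j).2.1) := by
    intro i j
    by_cases hij : i = j
    · subst hij
      exact ⟨fun _ => rfl, fun _ => rfl⟩
    · have h : ∃ p : (D → Y) × (Z → D),
          (p.1 (v i).2.1 = (v i).1 ∧ p.2 (v i).2.2 = (v i).2.1) ∧
          (p.1 (v j).2.1 = (v j).1 ∧ p.2 (v j).2.2 = (v j).2.1) := by
        by_contra hn
        exact hcon ⟨i, j, hij, hn⟩
      obtain ⟨p, ⟨h1, h2⟩, h3, h4⟩ := h
      refine ⟨fun h => ?_, fun h => ?_⟩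
      · rw [← h1, ← h3, h]
      · rw [← h2, ← h4, h]
  refine hempty ⟨(fun d => if h : ∃ k, (v k).2.1 = d then (v h.choose).1
      else Classical.arbitrary Y,
    fun z => if h : ∃ k, (v k).2.2 = z then (v h.choose).2.1
      else Classical.arbitrary D), fun k => ⟨?_, ?_⟩⟩
  · have h : ∃ l, (v l).2.1 = (v k).2.1 := ⟨k, rfl⟩
    simp only [dif_pos h]
    exact (hpair _ _).1 h.choose_spec
  · have h : ∃ l, (v l).2.2 = (v k).2.2 := ⟨k, rfl⟩
    simp only [dif_pos h]
    exact (hpair _ _).2 h.choose_spec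
end
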